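/- arXiv:1509.06308 — 6 statements merged into one kernel-verified Lean document; each statement's English description precedes it below -/
import Mathlib

section
/- For every ν ∈ ℝ and every real z > 0, F_ν^0(z) = (1/2)·K_{ν/2}(z/2)² and F_ν^1(z) = (1/2)·K_{(ν+1)/2}(z/2)·K_{(ν−1)/2}(z/2). -/
open Real MeasureTheory

/-- The modified Bessel function of the second kind, for `z > 0` and real order `ν`. -/
noncomputable def besselK (ν z : ℝ) : ℝ :=
  ∫ t in Set.Ioi (0 : ℝ), Real.exp (-z * Real.cosh t) * Real.cosh (ν * t)

/-- `F_ν^N(z) = ∫_0^∞ cosh^N(t) K_ν(z cosh t) dt`. -/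
noncomputable def F (N : ℕ) (ν : ℝ) (z : ℝ) : ℝ :=
  ∫ t in Set.Ioi (0 : ℝ), Real.cosh t ^ N * besselK ν (z * Real.cosh t)

theorem kInt (ν z : ℝ) (hz : 0 < z) :
    Integrable (fun t : ℝ => Real.exp (-z * Real.cosh t) * Real.exp (ν * t)) := by
  have h1 : Integrable (fun t : ℝ => Real.exp (ν ^ 2 / z) * Real.exp (-(z / 4) * t ^ 2)) :=
    (integrable_exp_neg_mul_sq (by positivity)).const_mul _
  refine h1.mono' (by fun_prop) (Filter.Eventually.of_forall fun t => ?_)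
  rw [Real.norm_of_nonneg (by positivity), ← Real.exp_add, ← Real.exp_add]
  apply Real.exp_le_exp.mpr
  have hc : t ^ 2 / 2 ≤ Real.cosh t := by
    rw [← Real.cosh_abs, ← sq_abs]
    have h := Real.cosh_sq (|t| / 2)
    have h2 := Real.cosh_two_mul (|t| / 2)
    have h3 : |t| / 2 ≤ Real.sinh (|t| / 2) := Real.self_le_sinh_iff.mpr (by positivity)
    rw [show 2 * (|t| / 2) = |t| by ring] at h2
    nlinarith [abs_nonneg t]
  have h4 : ν ^ 2 / z + -(z / 4) * t ^ 2 - (-z * (t ^ 2 / 2) + ν * t)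
      = (z * t / 2 - ν) ^ 2 / z := by
    field_simp; ring
  have h5 : 0 ≤ (z * t / 2 - ν) ^ 2 / z := by positivity
  nlinarith

theorem fold_integral (f : ℝ → ℝ) (hf : Integrable f) :
    ∫ t, f t = ∫ t in Set.Ioi (0 : ℝ), (f t + f (-t)) := by
  rw [integral_add hf.integrableOn hf.comp_neg.integrableOn, integral_comp_neg_Ioi, neg_zero,
    add_comm]
  exact (intervalIntegral.integral_Iic_add_Ioi hf.integrableOn hf.integrableOn).symm

theorem besselK_full (ν z : ℝ) (hz : 0 < z) :
    ∫ t : ℝ, Real.exp (-z * Real.cosh t) * Real.exp (ν * t) = 2 * besselK ν z := by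
  rw [fold_integral _ (kInt ν z hz), besselK, ← integral_const_mul]
  congr 1; ext t
  rw [Real.cosh_neg, Real.cosh_eq (ν * t)]
  ring_nf

theorem besselK_mul (μ ν x : ℝ) (hx : 0 < x) :
    besselK μ x * besselK ν x =
      2 * ∫ t in Set.Ioi (0 : ℝ), Real.cosh ((μ - ν) * t) *
        besselK (μ + ν) (2 * x * Real.cosh t) := by
  set g : ℝ → ℝ := fun t => Real.exp (-x * Real.cosh t) * Real.exp (μ * t) with hg
  set h : ℝ → ℝ := fun t => Real.exp (-x * Real.cosh t) * Real.exp (ν * t) with hh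
  have ig : Integrable g := kInt μ x hx
  have ih : Integrable h := kInt ν x hx
  have i2 : Integrable (fun p : ℝ × ℝ => h p.1 * g (p.1 + p.2)) (volume.prod volume) := by
    have := (measurePreserving_prod_add (volume : Measure ℝ) (volume : Measure ℝ)).integrable_comp_of_integrable
      (ih.mul_prod ig)
    exact this
  have key : ∀ b : ℝ, ∫ t, h t * g (t + 2 * b) =
      2 * (Real.exp ((μ - ν) * b) * besselK (μ + ν) (2 * x * Real.cosh b)) := by
    intro b
    rw [← integral_sub_right_eq_self _ b]
    rw [mul_left_comm, ← besselK_full _ _ (by have := Real.cosh_pos b; positivity),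
      ← integral_const_mul]
    congr 1; ext a
    simp only [hg, hh]
    rw [show a - b + 2 * b = a + b by ring]
    simp only [← Real.exp_add]
    rw [Real.cosh_add, Real.cosh_sub]
    ring_nf
  have i3 : Integrable (fun b : ℝ =>
      2 * (Real.exp ((μ - ν) * b) * besselK (μ + ν) (2 * x * Real.cosh b))) := by
    have := i2.integral_prod_right.comp_mul_left' (two_ne_zero : (2:ℝ) ≠ 0)
    refine this.congr (Filter.Eventually.of_forall fun b => ?_)
    exact key b
  have e1 : (∫ t, h t) * (∫ s, g s) =
      2 * ∫ b : ℝ, 2 * (Real.exp ((μ - ν) * b) * besselK (μ + ν) (2 * x * Real.cosh b)) := by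
    calc (∫ t, h t) * (∫ s, g s) = ∫ t, ∫ s, h t * g (t + s) := by
          rw [← integral_mul_const]
          congr 1; ext t
          rw [integral_const_mul, integral_add_left_eq_self g t]
      _ = ∫ s, ∫ t, h t * g (t + s) := integral_integral_swap i2
      _ = 2 * ∫ b, ∫ t, h t * g (t + 2 * b) := by
          rw [Measure.integral_comp_mul_left (fun s => ∫ t, h t * g (t + s)) 2]
          simp
      _ = _ := by simp_rw [key]
  rw [fold_integral _ i3, besselK_full _ _ hx, besselK_full _ _ hx] at e1
  have e2 : ∫ t in Set.Ioi (0 : ℝ),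
      (2 * (Real.exp ((μ - ν) * t) * besselK (μ + ν) (2 * x * Real.cosh t)) +
       2 * (Real.exp ((μ - ν) * -t) * besselK (μ + ν) (2 * x * Real.cosh (-t)))) =
      4 * ∫ t in Set.Ioi (0 : ℝ), Real.cosh ((μ - ν) * t) *
        besselK (μ + ν) (2 * x * Real.cosh t) := by
    rw [← integral_const_mul]
    congr 1; ext t
    rw [Real.cosh_neg, Real.cosh_eq ((μ - ν) * t)]
    ring_nf
  rw [e2] at e1
  linarith

theorem F_base_cases (ν : ℝ) (z : ℝ) (hz : 0 < z) :
    F 0 ν z = 1 / 2 * besselK (ν / 2) (z / 2) ^ 2 ∧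
    F 1 ν z = 1 / 2 * besselK ((ν + 1) / 2) (z / 2) * besselK ((ν - 1) / 2) (z / 2) := by
  have hx : 0 < z / 2 := by positivity
  have hz2 : 2 * (z / 2) = z := by ring
  constructor
  · rw [sq, besselK_mul _ _ _ hx, hz2, sub_self, add_halves]
    simp [F]
  · rw [mul_assoc, besselK_mul _ _ _ hx, hz2,
      show (ν + 1) / 2 - (ν - 1) / 2 = 1 by ring, show (ν + 1) / 2 + (ν - 1) / 2 = ν by ring]
    simp [F]
end

section
/- For every real z > 0: F_1^0(z) = (π/2)·z^{−1}·e^{−z}, F_0^1(z) = (π/2)·z^{−1}·e^{−z}, and F_2^1(z) = (π/2)·z^{−1}·e^{−z}·(1 + 2·z^{−1}). -/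
open Real MeasureTheory

open Filter Topology

lemma aux_subst (f f' : ℝ → ℝ) (hd : ∀ x, HasDerivAt f (f' x) x) (hm : StrictMono f)
    (h0 : f 0 = 0) (ht : Tendsto f atTop atTop) (u : ℝ → ENNReal) :
    ∫⁻ x in Set.Ioi (0 : ℝ), u x = ∫⁻ x in Set.Ioi (0 : ℝ), ENNReal.ofReal (f' x) * u (f x) := by
  have hc : Continuous f := continuous_iff_continuousAt.2 fun x => (hd x).continuousAt
  have him : f '' Set.Ioi 0 = Set.Ioi 0 := by
    ext y
    constructor
    · rintro ⟨x, hx, rfl⟩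
      have := hm (Set.mem_Ioi.1 hx)
      rw [h0] at this
      exact this
    · intro hy
      obtain ⟨b, hb⟩ := ((ht.eventually_ge_atTop y).and (eventually_ge_atTop 0)).exists
      obtain ⟨x, hx, hxy⟩ := intermediate_value_Icc hb.2 hc.continuousOn
        (show y ∈ Set.Icc (f 0) (f b) from ⟨by rw [h0]; exact le_of_lt hy, hb.1⟩)
      refine ⟨x, ?_, hxy⟩
      rcases hx.1.eq_or_lt with h | h
      · subst h
        rw [h0] at hxy
        exact absurd hxy (ne_of_lt hy)
      · exact h
  have := lintegral_image_eq_lintegral_deriv_mul_of_monotoneOn (s := Set.Ioi (0:ℝ)) (f := f) (f' := f')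
    measurableSet_Ioi (fun x _ => (hd x).hasDerivWithinAt) (hm.monotone.monotoneOn _) u
  rwa [him] at this

lemma aux_linear (c : ℝ) (hc : 0 < c) (u : ℝ → ENNReal) :
    ∫⁻ x in Set.Ioi (0 : ℝ), u x = ∫⁻ x in Set.Ioi (0 : ℝ), ENNReal.ofReal c * u (c * x) :=
  aux_subst (fun x => c * x) (fun _ => c) (fun x => by simpa using (hasDerivAt_id x).const_mul c)
    (fun a b h => mul_lt_mul_of_pos_left h hc) (by simp) (tendsto_id.const_mul_atTop hc) u

lemma aux_sinh_tendsto : Tendsto Real.sinh atTop atTop :=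
  tendsto_atTop_mono' atTop ((eventually_ge_atTop 0).mono fun x hx => Real.self_le_sinh_iff.2 hx)
    tendsto_id

lemma aux_sinh (c : ℝ) (hc : 0 < c) (u : ℝ → ENNReal) :
    ∫⁻ x in Set.Ioi (0 : ℝ), u x =
      ∫⁻ x in Set.Ioi (0 : ℝ), ENNReal.ofReal (c * Real.cosh x) * u (c * Real.sinh x) :=
  aux_subst (fun x => c * Real.sinh x) (fun x => c * Real.cosh x)
    (fun x => (Real.hasDerivAt_sinh x).const_mul c)
    (fun a b h => mul_lt_mul_of_pos_left (Real.sinh_lt_sinh.2 h) hc) (by simp)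
    (aux_sinh_tendsto.const_mul_atTop hc) u

lemma aux_arctan : ∫⁻ x in Set.Ioi (0 : ℝ), ENNReal.ofReal ((1 + x ^ 2)⁻¹) = ENNReal.ofReal (π / 2) := by
  rw [← ofReal_integral_eq_lintegral_ofReal integrable_inv_one_add_sq.integrableOn
    (ae_of_all _ fun x => by positivity)]
  simp

lemma aux_quadrant (H : ℝ → ENNReal) (hH : Measurable H) :
    ∫⁻ x in Set.Ioi (0 : ℝ), ∫⁻ y in Set.Ioi (0 : ℝ), H (x ^ 2 + y ^ 2) =
      ENNReal.ofReal (π / 2) * ∫⁻ v in Set.Ioi (0 : ℝ), ENNReal.ofReal v * H (v ^ 2) := by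
  calc _ = ∫⁻ x in Set.Ioi (0 : ℝ), ∫⁻ y in Set.Ioi (0 : ℝ),
        ENNReal.ofReal x * H (x ^ 2 + (x * y) ^ 2) := by
        refine setLIntegral_congr_fun measurableSet_Ioi fun x hx => ?_
        exact aux_linear x hx fun y => H (x ^ 2 + y ^ 2)
    _ = ∫⁻ y in Set.Ioi (0 : ℝ), ∫⁻ x in Set.Ioi (0 : ℝ),
        ENNReal.ofReal x * H (x ^ 2 + (x * y) ^ 2) := by
        apply lintegral_lintegral_swap
        apply Measurable.aemeasurable
        unfold Function.uncurry
        fun_prop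
    _ = ∫⁻ y in Set.Ioi (0 : ℝ), ENNReal.ofReal ((1 + y ^ 2)⁻¹) *
          ∫⁻ v in Set.Ioi (0 : ℝ), ENNReal.ofReal v * H (v ^ 2) := by
        refine setLIntegral_congr_fun measurableSet_Ioi fun y hy => ?_
        have hp : 0 < 1 + y ^ 2 := by positivity
        have hs : 0 < √(1 + y ^ 2) := Real.sqrt_pos.2 hp
        have hss := Real.sq_sqrt hp.le
        change ∫⁻ x in Set.Ioi (0 : ℝ), ENNReal.ofReal x * H (x ^ 2 + (x * y) ^ 2) = _
        rw [aux_linear (√(1 + y ^ 2)) hs (fun v => ENNReal.ofReal v * H (v ^ 2)),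
          ← lintegral_const_mul _ (by fun_prop)]
        refine lintegral_congr fun x => ?_
        rw [← mul_assoc, ← mul_assoc, ← ENNReal.ofReal_mul (by positivity),
          ← ENNReal.ofReal_mul (by positivity)]
        congr 2
        · field_simp
          rw [hss]
        · rw [mul_pow, mul_pow, hss]; ring
    _ = _ := by
        rw [lintegral_mul_const _ (by fun_prop), aux_arctan]

lemma aux_main (H : ℝ → ENNReal) (hH : Measurable H) :
    ∫⁻ s in Set.Ioi (0 : ℝ), ∫⁻ t in Set.Ioi (0 : ℝ),
      ENNReal.ofReal (Real.cosh s ^ 2 * Real.cosh t) * H ((Real.cosh s * Real.cosh t) ^ 2 - 1) =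
      ENNReal.ofReal (π / 2) * ∫⁻ v in Set.Ioi (0 : ℝ), ENNReal.ofReal v * H (v ^ 2) := by
  rw [← aux_quadrant H hH,
    aux_sinh 1 one_pos (fun x => ∫⁻ y in Set.Ioi (0 : ℝ), H (x ^ 2 + y ^ 2))]
  refine lintegral_congr fun s => ?_
  have hs := Real.cosh_pos s
  rw [aux_sinh (Real.cosh s) hs (fun y => H ((1 * Real.sinh s) ^ 2 + y ^ 2)), ← lintegral_const_mul _ (by fun_prop)]
  refine lintegral_congr fun t => ?_
  have ht := Real.cosh_pos t
  rw [← mul_assoc, ← ENNReal.ofReal_mul (by positivity)]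
  congr 2
  · ring
  · have h1 := Real.cosh_sq s
    have h2 := Real.cosh_sq t
    rw [mul_pow, h2]
    linear_combination h1

/-- Fundamental theorem of calculus for the radial integral. -/
lemma aux_radial (g : ℝ → ℝ) (G : ℝ → ℝ)
    (hd : ∀ r, 0 < r → HasDerivAt G (g r) r) (hg : ∀ r, 0 < r → 0 ≤ g r)
    (ht : Tendsto G atTop (𝓝 0)) :
    ∫⁻ v in Set.Ioi (0 : ℝ), ENNReal.ofReal v * ENNReal.ofReal (g (√(v ^ 2 + 1)) / √(v ^ 2 + 1)) =
      ENNReal.ofReal (- G 1) := by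
  have hp : ∀ v : ℝ, 0 < √(v ^ 2 + 1) := fun v => Real.sqrt_pos.2 (by positivity)
  have hdd : ∀ v ∈ Set.Ici (0:ℝ), HasDerivAt (fun v => G (√(v ^ 2 + 1)))
      (v * (g (√(v ^ 2 + 1)) / √(v ^ 2 + 1))) v := by
    intro v _
    have h1 : HasDerivAt (fun v : ℝ => v ^ 2 + 1) (2 * v) v := by
      simpa using (hasDerivAt_pow 2 v).add_const 1
    have h2 := h1.sqrt (by positivity)
    have h3 := (hd _ (hp v)).comp v h2
    refine h3.congr_deriv ?_
    have := hp v
    field_simp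
  have hpos : ∀ v ∈ Set.Ioi (0:ℝ), 0 ≤ v * (g (√(v ^ 2 + 1)) / √(v ^ 2 + 1)) := fun v hv =>
    mul_nonneg (le_of_lt hv) (div_nonneg (hg _ (hp v)) (hp v).le)
  have htt : Tendsto (fun v : ℝ => G (√(v ^ 2 + 1))) atTop (𝓝 0) := by
    refine ht.comp (tendsto_atTop_mono (fun v => ?_) tendsto_id)
    exact Real.le_sqrt_of_sq_le (by simp)
  have hI := integral_Ioi_of_hasDerivAt_of_nonneg' hdd hpos htt
  have hi := integrableOn_Ioi_deriv_of_nonneg' hdd hpos htt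
  have h4 := ofReal_integral_eq_lintegral_ofReal hi
    ((ae_restrict_iff' measurableSet_Ioi).2 (ae_of_all _ hpos))
  rw [hI] at h4
  simp only [zero_sub, ne_eq, OfNat.ofNat_ne_zero, not_false_eq_true, zero_pow, zero_add,
    Real.sqrt_one] at h4
  rw [h4]
  refine setLIntegral_congr_fun measurableSet_Ioi fun v hv => ?_
  exact (ENNReal.ofReal_mul (le_of_lt hv)).symm

lemma aux_double (g : ℝ → ℝ) (G : ℝ → ℝ) (hgm : Measurable g)
    (hd : ∀ r, 0 < r → HasDerivAt G (g r) r) (hg : ∀ r, 0 < r → 0 ≤ g r)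
    (ht : Tendsto G atTop (𝓝 0)) :
    ∫⁻ s in Set.Ioi (0 : ℝ), ∫⁻ t in Set.Ioi (0 : ℝ),
      ENNReal.ofReal (Real.cosh s * g (Real.cosh s * Real.cosh t)) =
      ENNReal.ofReal (π / 2 * (- G 1)) := by
  have h := aux_main (fun q => ENNReal.ofReal (g (√(q + 1)) / √(q + 1))) (by fun_prop)
  rw [aux_radial g G hd hg ht, ← ENNReal.ofReal_mul (by positivity)] at h
  rw [← h]
  refine lintegral_congr fun s => lintegral_congr fun t => ?_
  have hs := Real.cosh_pos s
  have ht := Real.cosh_pos t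
  rw [← ENNReal.ofReal_mul (by positivity), sub_add_cancel, Real.sqrt_sq (by positivity)]
  congr 1
  field_simp

lemma aux_bridge (w : ℝ × ℝ → ℝ) (hw : Continuous w) (h0 : ∀ p, 0 ≤ w p) (c : ℝ) (hc : 0 ≤ c)
    (h : ∫⁻ s in Set.Ioi (0 : ℝ), ∫⁻ t in Set.Ioi (0 : ℝ), ENNReal.ofReal (w (s, t)) =
      ENNReal.ofReal c) :
    Integrable w ((volume.restrict (Set.Ioi (0 : ℝ))).prod (volume.restrict (Set.Ioi (0 : ℝ)))) ∧
    ∫ p, w p ∂((volume.restrict (Set.Ioi (0 : ℝ))).prod (volume.restrict (Set.Ioi (0 : ℝ)))) = c := by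
  have hl := lintegral_prod (μ := volume.restrict (Set.Ioi (0 : ℝ)))
    (ν := volume.restrict (Set.Ioi (0 : ℝ))) (fun p => ENNReal.ofReal (w p))
    (by have := hw.measurable; fun_prop)
  rw [h] at hl
  refine ⟨⟨hw.aestronglyMeasurable, ?_⟩, ?_⟩
  · rw [hasFiniteIntegral_iff_ofReal (ae_of_all _ h0), hl]
    exact ENNReal.ofReal_lt_top
  · rw [integral_eq_lintegral_of_nonneg_ae (ae_of_all _ h0) hw.aestronglyMeasurable, hl,
      ENNReal.toReal_ofReal hc]

lemma aux_exp_tendsto (z : ℝ) (hz : 0 < z) :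
    Tendsto (fun r : ℝ => Real.exp (-(z * r))) atTop (𝓝 0) :=
  Real.tendsto_exp_neg_atTop_nhds_zero.comp (tendsto_id.const_mul_atTop hz)

lemma aux_rexp_tendsto (z : ℝ) (hz : 0 < z) :
    Tendsto (fun r : ℝ => r * Real.exp (-(z * r))) atTop (𝓝 0) := by
  have h := (Real.tendsto_pow_mul_exp_neg_atTop_nhds_zero 1).comp (tendsto_id.const_mul_atTop hz)
  have h2 := h.const_mul z⁻¹
  simp only [mul_zero] at h2
  refine h2.congr fun r => ?_
  simp
  field_simp

theorem F_explicit_base_cases (z : ℝ) (hz : 0 < z) :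
    F 0 1 z = π / 2 * z⁻¹ * Real.exp (-z) ∧
    F 1 0 z = π / 2 * z⁻¹ * Real.exp (-z) ∧
    F 1 2 z = π / 2 * z⁻¹ * Real.exp (-z) * (1 + 2 * z⁻¹) := by
  have hE : ∀ r : ℝ, HasDerivAt (fun r => Real.exp (-(z * r))) (-(z * Real.exp (-(z * r)))) r := by
    intro r
    have h1 : HasDerivAt (fun r : ℝ => -(z * r)) (-z) r := by
      simpa using (hasDerivAt_id r).const_mul (-z)
    exact h1.exp.congr_deriv (by ring)
  have hA := aux_double (fun r => Real.exp (-(z * r))) (fun r => -(z⁻¹ * Real.exp (-(z * r))))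
    (by fun_prop)
    (fun r _ => (((hE r).const_mul z⁻¹).neg).congr_deriv (by field_simp))
    (fun r _ => (Real.exp_pos _).le) (by simpa using ((aux_exp_tendsto z hz).const_mul z⁻¹).neg)
  have hB := aux_double (fun r => r * Real.exp (-(z * r)))
    (fun r => -(z⁻¹ * (r * Real.exp (-(z * r))) + z⁻¹ ^ 2 * Real.exp (-(z * r))))
    (by fun_prop)
    (fun r _ => (((((hasDerivAt_id r).mul (hE r)).const_mul z⁻¹).add
      ((hE r).const_mul (z⁻¹ ^ 2))).neg).congr_deriv (by simp only [id]; field_simp; ring))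
    (fun r hr => mul_nonneg hr.le (Real.exp_pos _).le)
    (by simpa only [mul_zero, add_zero, neg_zero] using (((aux_rexp_tendsto z hz).const_mul z⁻¹).add
      ((aux_exp_tendsto z hz).const_mul (z⁻¹ ^ 2))).neg)
  obtain ⟨iA, eA⟩ := aux_bridge
    (fun p => Real.cosh p.1 * Real.exp (-(z * (Real.cosh p.1 * Real.cosh p.2))))
    (by fun_prop) (fun p => mul_nonneg (Real.cosh_pos _).le (Real.exp_pos _).le) _
    (by simp only [neg_neg]; positivity) hA
  obtain ⟨iB, eB⟩ := aux_bridge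
    (fun p => Real.cosh p.1 * ((Real.cosh p.1 * Real.cosh p.2) *
      Real.exp (-(z * (Real.cosh p.1 * Real.cosh p.2)))))
    (by fun_prop) (fun p => by
      have h1 := Real.cosh_pos p.1
      have h2 := Real.cosh_pos p.2
      positivity) _
    (by simp only [neg_neg]; positivity) hB
  refine ⟨?_, ?_, ?_⟩
  · have h := integral_prod_symm _ iA
    rw [eA] at h
    simp only [neg_neg, mul_one] at h
    unfold F besselK
    rw [mul_assoc, h]
    refine integral_congr_ae (ae_of_all _ fun t => ?_)
    simp only [pow_zero, one_mul]
    refine integral_congr_ae (ae_of_all _ fun s => ?_)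
    simp only
    rw [mul_comm]
    congr 2
    ring
  · have h := integral_prod _ iA
    rw [eA] at h
    simp only [neg_neg, mul_one] at h
    unfold F besselK
    rw [mul_assoc, h]
    refine integral_congr_ae (ae_of_all _ fun t => ?_)
    simp only [pow_one, zero_mul, Real.cosh_zero, mul_one]
    rw [← integral_const_mul]
    refine integral_congr_ae (ae_of_all _ fun s => ?_)
    simp only
    congr 2
    ring
  · have iB2 := (iB.swap.const_mul 2)
    have h := integral_prod _ (iB2.sub iA)
    have h2 := integral_sub iB2 iA
    simp only [Pi.sub_apply] at h
    rw [h, integral_const_mul, eA] at h2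
    simp only [Function.comp_apply] at h2
    rw [integral_prod_swap (fun p : ℝ × ℝ => Real.cosh p.1 * ((Real.cosh p.1 * Real.cosh p.2) *
      Real.exp (-(z * (Real.cosh p.1 * Real.cosh p.2))))), eB] at h2
    simp only [neg_neg, mul_one, one_mul] at h2
    unfold F besselK
    trans 2 * (π / 2 * (z⁻¹ * rexp (-z) + z⁻¹ ^ 2 * rexp (-z))) - π / 2 * (z⁻¹ * rexp (-z))
    · rw [← h2]
      refine integral_congr_ae (ae_of_all _ fun t => ?_)
      simp only [pow_one]
      rw [← integral_const_mul]
      refine integral_congr_ae (ae_of_all _ fun s => ?_)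
      simp only [Prod.fst_swap, Prod.snd_swap]
      have h3 : -(z * Real.cosh t) * Real.cosh s = -(z * (Real.cosh t * Real.cosh s)) := by ring
      rw [Real.cosh_two_mul, Real.sinh_sq, h3, mul_comm (Real.cosh s) (Real.cosh t)]
      ring
    · ring
end

section
/- For every integer n ≥ 1 there exists a real polynomial R of degree at most 2n−2 such that for all real z > 0: F_{2n+1}^0(z) = (2^{2n}·π·(∏_{j=1}^{n−1}(2(n−j)+1))²/2)·z^{−1}·e^{−z}·( z^{−2n} + z^{−(2n−1)} + R(1/z) ) (the product over the empty range, when n = 1, equals 1). -/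
open Real MeasureTheory Finset

/-- Exponential form of the integrand. -/
noncomputable def fB (ν x t : ℝ) : ℝ := Real.exp (-x * Real.cosh t) * Real.exp (ν * t)

/-- Full-line integral, equal to `2 K_ν(x)`. -/
noncomputable def IB (ν x : ℝ) : ℝ := ∫ t : ℝ, fB ν x t

lemma fB_cont (ν x : ℝ) : Continuous (fB ν x) := by
  unfold fB
  fun_prop

lemma fB_pos (ν x t : ℝ) : 0 < fB ν x t := by
  unfold fB
  positivity

lemma sq_div_four_le_cosh (t : ℝ) : t ^ 2 / 4 ≤ Real.cosh t := by
  rw [← Real.cosh_abs, Real.cosh_eq]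
  have h := Real.quadratic_le_exp_of_nonneg (abs_nonneg t)
  have h2 := Real.exp_pos (-|t|)
  have h3 := abs_nonneg t
  have h4 := sq_abs t
  nlinarith

lemma fB_int (ν x : ℝ) (hx : 0 < x) : Integrable (fB ν x) := by
  have h := (integrable_exp_neg_mul_sq (b := x / 8) (by positivity)).const_mul
    (Real.exp (2 * ν ^ 2 / x))
  refine h.mono' (fB_cont ν x).aestronglyMeasurable (Filter.Eventually.of_forall fun t => ?_)
  rw [Real.norm_of_nonneg (fB_pos ν x t).le]
  unfold fB
  rw [← Real.exp_add, ← Real.exp_add]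
  apply Real.exp_le_exp.mpr
  have h1 := mul_le_mul_of_nonneg_left (sq_div_four_le_cosh t) hx.le
  have h2 : 0 ≤ (x * t - 4 * ν) ^ 2 / (8 * x) := by positivity
  have h3 : (x * t - 4 * ν) ^ 2 / (8 * x) = x * t ^ 2 / 8 - ν * t + 2 * ν ^ 2 / x := by
    field_simp
    ring
  rw [h3] at h2
  linarith

lemma IB_neg (ν x : ℝ) : IB (-ν) x = IB ν x := by
  unfold IB
  rw [← integral_neg_eq_self]
  congr 1
  ext t
  simp [fB]

lemma IB_rec (ν x : ℝ) (hx : 0 < x) :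
    IB (ν + 1) x = IB (ν - 1) x + 2 * ν / x * IB ν x := by
  have e1 : ∀ t, Real.sinh t * fB ν x t = (fB (ν + 1) x t - fB (ν - 1) x t) / 2 := by
    intro t
    have a : Real.exp ((ν + 1) * t) = Real.exp (ν * t) * Real.exp t := by
      rw [← Real.exp_add]; ring_nf
    have b : Real.exp ((ν - 1) * t) = Real.exp (ν * t) * Real.exp (-t) := by
      rw [← Real.exp_add]; ring_nf
    unfold fB
    rw [a, b, Real.sinh_eq]
    ring
  have hd : ∀ t, HasDerivAt (fB ν x)
      (ν * fB ν x t - x / 2 * (fB (ν + 1) x t - fB (ν - 1) x t)) t := by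
    intro t
    have h1 : HasDerivAt (fun t => Real.exp (-x * Real.cosh t))
        (Real.exp (-x * Real.cosh t) * (-x * Real.sinh t)) t :=
      ((Real.hasDerivAt_cosh t).const_mul (-x)).exp
    have h2 : HasDerivAt (fun t => Real.exp (ν * t)) (Real.exp (ν * t) * (ν * 1)) t :=
      ((hasDerivAt_id t).const_mul ν).exp
    have h3 := h1.mul h2
    have e := e1 t
    refine HasDerivAt.congr_deriv (f := fB ν x) h3 ?_
    have : ν * fB ν x t - x / 2 * (fB (ν + 1) x t - fB (ν - 1) x t)
      = ν * fB ν x t - x * (Real.sinh t * fB ν x t) := by rw [e]; ring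
    rw [this]
    unfold fB
    ring
  have i0 := fB_int ν x hx
  have i1 := fB_int (ν + 1) x hx
  have i2 := fB_int (ν - 1) x hx
  have i3 : Integrable (fun t => x / 2 * (fB (ν + 1) x t - fB (ν - 1) x t)) :=
    (i1.sub i2).const_mul (x / 2)
  have h := integral_eq_zero_of_hasDerivAt_of_integrable hd
    ((i0.const_mul ν).sub i3) i0
  rw [integral_sub (i0.const_mul ν) i3, integral_const_mul,
    integral_const_mul, integral_sub i1 i2] at h
  change ν * IB ν x - x / 2 * (IB (ν + 1) x - IB (ν - 1) x) = 0 at h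
  field_simp
  linarith

lemma IB_cosh (ν x : ℝ) (hx : 0 < x) :
    IB ν x = ∫ t : ℝ, Real.exp (-x * Real.cosh t) * Real.cosh (ν * t) := by
  have h : IB ν x = (IB ν x + IB (-ν) x) / 2 := by rw [IB_neg]; ring
  rw [h]
  unfold IB
  rw [← integral_add (fB_int ν x hx) (fB_int (-ν) x hx), ← integral_div]
  congr 1
  ext t
  unfold fB
  rw [Real.cosh_eq (ν * t), neg_mul ν t]
  ring

lemma besselK_eq (ν x : ℝ) (hx : 0 < x) : besselK ν x = IB ν x / 2 := by
  rw [IB_cosh ν x hx]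
  have h := integral_comp_abs (f := fun t => Real.exp (-x * Real.cosh t) * Real.cosh (ν * t))
  have e : ∀ t : ℝ, Real.cosh (ν * |t|) = Real.cosh (ν * t) := by
    intro t
    rcases abs_choice t with h | h <;> rw [h]
    rw [mul_neg, Real.cosh_neg]
  simp only [Real.cosh_abs, e] at h
  rw [h]
  unfold besselK
  ring

lemma IB_half (x : ℝ) (hx : 0 < x) : IB (1 / 2) x = 2 * (Real.exp (-x) * √(π / (2 * x))) := by
  rw [IB_cosh _ x hx]
  have hd : ∀ t ∈ (Set.univ : Set ℝ), HasDerivWithinAt (fun t : ℝ => Real.sinh (1 / 2 * t))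
      (Real.cosh (1 / 2 * t) * (1 / 2 * 1)) Set.univ t := by
    intro t _
    exact (((hasDerivAt_id t).const_mul (1 / 2 : ℝ)).sinh).hasDerivWithinAt
  have hinj : Function.Injective (fun t : ℝ => Real.sinh (1 / 2 * t)) := by
    intro a b hab
    have := Real.sinh_injective hab
    linarith
  have hsurj : Function.Surjective (fun t : ℝ => Real.sinh (1 / 2 * t)) := by
    intro b
    obtain ⟨a, ha⟩ := Real.sinh_surjective b
    exact ⟨2 * a, by simp [← ha]⟩
  have h := integral_image_eq_integral_abs_deriv_smul MeasurableSet.univ hd hinj.injOn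
    (fun w => Real.exp (-(2 * x) * w ^ 2))
  rw [Set.image_univ, hsurj.range_eq, setIntegral_univ, setIntegral_univ, integral_gaussian] at h
  rw [h, ← integral_const_mul, ← integral_const_mul]
  congr 1
  ext t
  have hc := Real.cosh_pos (1 / 2 * t)
  rw [abs_of_pos (by positivity), smul_eq_mul]
  have e : Real.cosh t = 1 + 2 * Real.sinh (1 / 2 * t) ^ 2 := by
    have := Real.cosh_two_mul (1 / 2 * t)
    rw [Real.cosh_sq] at this
    rw [show 2 * (1 / 2 * t) = t by ring] at this
    linarith
  have e2 : Real.exp (-x * Real.cosh t)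
      = Real.exp (-x) * Real.exp (-(2 * x) * Real.sinh (1 / 2 * t) ^ 2) := by
    rw [← Real.exp_add, e]; ring_nf
  rw [e2]
  ring

lemma IB_prod (ν z : ℝ) (hz : 0 < z) :
    ∫ t : ℝ, IB ν (z * Real.cosh t) = IB (ν / 2) (z / 2) ^ 2 / 2 := by
  have hz2 : 0 < z / 2 := by positivity
  set f := fB (ν / 2) (z / 2) with hf
  have fi : Integrable f := fB_int _ _ hz2
  have fc : Continuous f := fB_cont _ _
  have step1 : ∀ t, IB ν (z * Real.cosh t) = ∫ v : ℝ, f v * f (2 * t + v) := by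
    intro t
    unfold IB
    rw [← integral_add_right_eq_self _ t]
    congr 1
    ext v
    simp only [hf, fB]
    have h1 : Real.cosh t * Real.cosh (v + t) = (Real.cosh v + Real.cosh (2 * t + v)) / 2 := by
      have a := Real.cosh_add (v + t) t
      have b := Real.cosh_sub (v + t) t
      rw [show v + t + t = 2 * t + v by ring] at a
      rw [show v + t - t = v by ring] at b
      rw [a, b]
      ring
    simp only [← Real.exp_add]
    congr 1
    linear_combination -z * h1
  have inner : ∀ v, ∫ t : ℝ, f v * f (2 * t + v) = f v * (IB (ν / 2) (z / 2) / 2) := by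
    intro v
    rw [integral_const_mul]
    congr 1
    have h := Measure.integral_comp_mul_left (fun u => f (u + v)) (2 : ℝ)
    rw [h, integral_add_right_eq_self (fun u => f u) v]
    simp [IB, hf]
    ring
  have hint : Integrable (Function.uncurry fun t v => f v * f (2 * t + v))
      ((volume : Measure ℝ).prod volume) := by
    have hc : Continuous (Function.uncurry fun t v => f v * f (2 * t + v)) := by
      unfold Function.uncurry
      fun_prop
    rw [integrable_prod_iff' hc.aestronglyMeasurable]
    constructor
    · refine Filter.Eventually.of_forall fun v => ?_
      simp only [Function.uncurry]
      exact ((fi.comp_add_right v).comp_mul_left' (two_ne_zero)).const_mul (f v)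
    · have : ∀ v t, ‖Function.uncurry (fun t v => f v * f (2 * t + v)) (t, v)‖
          = f v * f (2 * t + v) := fun v t =>
        Real.norm_of_nonneg (mul_pos (fB_pos _ _ _) (fB_pos _ _ _)).le
      simp only [this, inner]
      exact fi.mul_const _
  simp only [step1]
  rw [integral_integral_swap hint]
  simp only [inner]
  rw [integral_mul_const]
  change IB (ν / 2) (z / 2) * _ = _
  ring

lemma F_eq (ν z : ℝ) (hz : 0 < z) : F 0 ν z = IB (ν / 2) (z / 2) ^ 2 / 8 := by
  have h := integral_comp_abs (f := fun t => besselK ν (z * Real.cosh t))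
  simp only [Real.cosh_abs] at h
  have e : ∀ t, besselK ν (z * Real.cosh t) = IB ν (z * Real.cosh t) / 2 := fun t =>
    besselK_eq _ _ (mul_pos hz (Real.cosh_pos t))
  have h2 : F 0 ν z = ∫ t in Set.Ioi (0 : ℝ), besselK ν (z * Real.cosh t) := by
    unfold F
    simp
  rw [h2]
  simp only [e] at h ⊢
  rw [integral_div, IB_prod ν z hz] at h
  linarith

open Polynomial in
/-- Bessel polynomials. -/
noncomputable def PB : ℕ → Polynomial ℝ
  | 0 => 1
  | 1 => 1 + C 2 * X
  | (n + 2) => PB n + C (4 * (n : ℝ) + 6) * X * PB (n + 1)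

lemma IB_PB (z : ℝ) (hz : 0 < z) (n : ℕ) :
    IB ((n : ℝ) + 1 / 2) (z / 2) = (PB n).eval (1 / z) * IB (1 / 2) (z / 2) := by
  have hz2 : 0 < z / 2 := by positivity
  induction n using Nat.twoStepInduction with
  | zero => simp [PB]
  | one =>
    have h := IB_rec (1 / 2) (z / 2) hz2
    rw [show (1 / 2 - 1 : ℝ) = -(1 / 2) by norm_num, IB_neg] at h
    rw [show ((1 : ℕ) : ℝ) + 1 / 2 = 1 / 2 + 1 by push_cast; ring, h]
    simp only [PB, Polynomial.eval_add, Polynomial.eval_mul, Polynomial.eval_C,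
      Polynomial.eval_X, Polynomial.eval_one]
    field_simp
  | more n h0 h1 =>
    have h := IB_rec ((n : ℝ) + 1 + 1 / 2) (z / 2) hz2
    push_cast at h1 ⊢
    rw [show (n : ℝ) + 1 + 1 / 2 - 1 = n + 1 / 2 by ring, h0, h1] at h
    rw [show (n : ℝ) + 2 + 1 / 2 = (n : ℝ) + 1 + 1 / 2 + 1 by ring, h]
    simp only [PB, Polynomial.eval_add, Polynomial.eval_mul, Polynomial.eval_C,
      Polynomial.eval_X]
    field_simp
    ring

/-- Leading coefficient. -/
noncomputable def aB (n : ℕ) : ℝ := 2 ^ n * ∏ j ∈ Finset.range n, (2 * (j : ℝ) + 1)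

lemma aB_succ (n : ℕ) : aB (n + 1) = (4 * (n : ℝ) + 2) * aB n := by
  unfold aB
  rw [Finset.prod_range_succ]
  ring

lemma aB_pos (n : ℕ) : 0 < aB n := by
  unfold aB
  positivity

open Polynomial in
lemma PB_deg (n : ℕ) : (PB n).natDegree ≤ n := by
  induction n using Nat.twoStepInduction with
  | zero => simp [PB]
  | one => unfold PB; compute_degree
  | more n h0 h1 =>
    unfold PB
    refine natDegree_add_le_of_degree_le (by omega) ?_
    refine natDegree_mul_le_of_le (m := 1) ?_ h1 |>.trans (by omega)
    compute_degree

open Polynomial in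
lemma PB_shape (m : ℕ) : ∃ Q : Polynomial ℝ, Q.natDegree ≤ m ∧ (X * Q).natDegree ≤ m ∧
    PB (m + 1) = C (aB (m + 1)) * (X + C (1 / 2)) * X ^ m + Q := by
  induction m with
  | zero =>
    refine ⟨0, by simp, by simp, ?_⟩
    simp only [PB, aB]
    norm_num
    rw [mul_add, ← C_mul]
    norm_num
    ring
  | succ m ih =>
    obtain ⟨Q, h1, h2, h3⟩ := ih
    have hc : (C (4 * (m : ℝ) + 6) * (X * Q)).natDegree ≤ m := 
      (natDegree_C_mul_le _ _).trans h2
    refine ⟨PB m + C (4 * (m : ℝ) + 6) * (X * Q), ?_, ?_, ?_⟩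
    · exact natDegree_add_le_of_degree_le ((PB_deg m).trans (by omega)) (hc.trans (by omega))
    · rw [mul_add]
      refine natDegree_add_le_of_degree_le ?_ ?_
      · exact (natDegree_mul_le_of_le natDegree_X_le (PB_deg m)).trans (by omega)
      · exact (natDegree_mul_le_of_le natDegree_X_le hc).trans (by omega)
    · rw [PB, h3, aB_succ (m + 1)]
      rw [show (4 * ((m + 1 : ℕ) : ℝ) + 2) = 4 * (m : ℝ) + 6 by push_cast; ring, C_mul]
      ring

lemma aB_prod (m : ℕ) : aB (m + 1) = 2 ^ (m + 1) *
    ∏ j ∈ Finset.range m, (2 * (((m + 1 : ℕ) : ℝ) - (j + 1)) + 1) := by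
  unfold aB
  congr 1
  rw [Finset.prod_range_succ', ← Finset.prod_range_reflect]
  simp only [Nat.cast_zero, mul_zero, zero_add, mul_one]
  refine Finset.prod_congr rfl fun j hj => ?_
  have hj' := Finset.mem_range.mp hj
  have : ((m - 1 - j : ℕ) : ℝ) = (m : ℝ) - 1 - j := by
    rw [Nat.cast_sub (by omega), Nat.cast_sub (by omega)]
    simp
  push_cast
  rw [this]
  ring

theorem F_zero_odd_leading_order (n : ℕ) (hn : 1 ≤ n) :
    ∃ R : Polynomial ℝ, R.natDegree ≤ 2 * n - 2 ∧
      ∀ z : ℝ, 0 < z →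
        F 0 (2 * (n : ℝ) + 1) z =
          (2 ^ (2 * n) * π *
              (∏ j ∈ Finset.range (n - 1), (2 * ((n : ℝ) - (j + 1)) + 1)) ^ 2 / 2) *
            z⁻¹ * Real.exp (-z) *
            (z ^ (-(2 * (n : ℝ))) + z ^ (-(2 * (n : ℝ) - 1)) + R.eval (1 / z)) := by
  obtain ⟨m, rfl⟩ : ∃ m, n = m + 1 := ⟨n - 1, by omega⟩
  obtain ⟨Q, h1, h2, h3⟩ := PB_shape m
  have ha := aB_pos (m + 1)
  set a := aB (m + 1) with hadef
  refine ⟨Polynomial.C (1 / 4) * Polynomial.X ^ (2 * m)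
    + Polynomial.C (2 / a) * (Polynomial.X ^ m * (Polynomial.X * Q + Polynomial.C (1 / 2) * Q))
    + Polynomial.C (1 / a ^ 2) * (Q * Q), ?_, ?_⟩
  · refine Polynomial.natDegree_add_le_of_degree_le
      (Polynomial.natDegree_add_le_of_degree_le ?_ ?_) ?_
    · exact (Polynomial.natDegree_C_mul_X_pow_le _ _).trans (by omega)
    · refine (Polynomial.natDegree_C_mul_le _ _).trans ?_
      refine (Polynomial.natDegree_mul_le_of_le (Polynomial.natDegree_X_pow_le m)
        (Polynomial.natDegree_add_le_of_degree_le h2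
          ((Polynomial.natDegree_C_mul_le _ _).trans h1))).trans (by omega)
    · refine (Polynomial.natDegree_C_mul_le _ _).trans ?_
      exact (Polynomial.natDegree_mul_le_of_le h1 h1).trans (by omega)
  · intro z hz
    rw [F_eq _ _ hz, show (2 * ((m + 1 : ℕ) : ℝ) + 1) / 2 = ((m + 1 : ℕ) : ℝ) + 1 / 2 by ring,
      IB_PB z hz, IB_half _ (by positivity : 0 < z / 2), h3]
    have hp : (2 : ℝ) ^ (2 * (m + 1)) * π *
        (∏ j ∈ Finset.range (m + 1 - 1), (2 * (((m + 1 : ℕ) : ℝ) - (j + 1)) + 1)) ^ 2 / 2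
        = a ^ 2 * π / 2 := by
      rw [hadef, aB_prod m, Nat.add_sub_cancel]
      ring
    rw [hp]
    have r1 : z ^ (-(2 * ((m + 1 : ℕ) : ℝ))) = (1 / z) ^ (2 * m + 2) := by
      rw [show (2 * ((m + 1 : ℕ) : ℝ)) = ((2 * m + 2 : ℕ) : ℝ) by push_cast; ring,
        Real.rpow_neg hz.le, Real.rpow_natCast, one_div, inv_pow]
    have r2 : z ^ (-(2 * ((m + 1 : ℕ) : ℝ) - 1)) = (1 / z) ^ (2 * m + 1) := by
      rw [show (2 * ((m + 1 : ℕ) : ℝ) - 1) = ((2 * m + 1 : ℕ) : ℝ) by push_cast; ring,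
        Real.rpow_neg hz.le, Real.rpow_natCast, one_div, inv_pow]
    rw [r1, r2]
    have hs : √(π / (2 * (z / 2))) ^ 2 = π * z⁻¹ := by
      rw [Real.sq_sqrt (by positivity)]
      field_simp
    have he : Real.exp (-(z / 2)) ^ 2 = Real.exp (-z) := by
      rw [← Real.exp_nat_mul]
      congr 1
      push_cast
      ring
    simp only [Polynomial.eval_add, Polynomial.eval_mul, Polynomial.eval_C,
      Polynomial.eval_X, Polynomial.eval_pow]
    rw [mul_pow, mul_pow, mul_pow, hs, he]
    generalize Polynomial.eval (1 / z) Q = q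
    generalize 1 / z = y
    field_simp
    ring
end

section
/- For every integer n ≥ 2 there exists a real polynomial R of degree at most 2n−3 such that for all real z > 0: F_{2n}^1(z) = (2^{2n−1}·π·(∏_{j=1}^{n−1}(2(n−j)+1))²/(2(2n−1)))·z^{−1}·e^{−z}·( z^{−(2n−1)} + z^{−(2n−2)} + R(1/z) ). -/
open Real MeasureTheory Finset

/-- Full-line integral, equal to `2 K_ν(x)`. -/
noncomputable def GG (ν x : ℝ) : ℝ := ∫ u : ℝ, Real.exp (ν * u - x * Real.cosh u)

lemma cosh_lower (u : ℝ) : u ^ 2 / 2 ≤ Real.cosh u := by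
  have h1 : Real.cosh u = 1 + 2 * Real.sinh (u / 2) ^ 2 := by
    have := Real.cosh_two_mul (u / 2)
    rw [Real.cosh_sq, mul_div_cancel₀ u (two_ne_zero)] at this
    linarith
  have h2 : (u / 2) ^ 2 ≤ Real.sinh (u / 2) ^ 2 := by
    rw [sq_le_sq, Real.abs_sinh]
    exact Real.self_le_sinh_iff.2 (abs_nonneg _)
  nlinarith

lemma GG_int (ν : ℝ) {x : ℝ} (hx : 0 < x) :
    Integrable (fun u : ℝ => Real.exp (ν * u - x * Real.cosh u)) := by
  refine ((integrable_exp_neg_mul_sq (b := x / 4) (by positivity)).const_mul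
    (Real.exp (ν ^ 2 / x))).mono' (by fun_prop) (Filter.Eventually.of_forall fun u => ?_)
  rw [Real.norm_eq_abs, abs_of_pos (Real.exp_pos _), ← Real.exp_add]
  apply Real.exp_le_exp.2
  have h := mul_le_mul_of_nonneg_left (cosh_lower u) hx.le
  have h3 : ν ^ 2 / x + -(x / 4) * u ^ 2 - (ν * u - x * (u ^ 2 / 2)) = (x * u / 2 - ν) ^ 2 / x := by
    field_simp
    ring
  have h4 : 0 ≤ (x * u / 2 - ν) ^ 2 / x := by positivity
  linarith

lemma GG_rec (ν : ℝ) {x : ℝ} (hx : 0 < x) :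
    GG (ν + 1) x = GG (ν - 1) x + 2 * ν / x * GG ν x := by
  have e : ∀ u : ℝ, Real.exp (ν * u - x * Real.cosh u) * (ν - x * Real.sinh u) =
      ν * Real.exp (ν * u - x * Real.cosh u) - x / 2 * (Real.exp ((ν + 1) * u - x * Real.cosh u) -
        Real.exp ((ν - 1) * u - x * Real.cosh u)) := by
    intro u
    have e1 : (ν + 1) * u - x * Real.cosh u = (ν * u - x * Real.cosh u) + u := by ring
    have e2 : (ν - 1) * u - x * Real.cosh u = (ν * u - x * Real.cosh u) + -u := by ring
    rw [e1, e2, Real.exp_add, Real.exp_add, Real.sinh_eq]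
    ring
  have i0 := (GG_int ν hx).const_mul ν
  have i1 := GG_int (ν + 1) hx
  have i2 := GG_int (ν - 1) hx
  have key := integral_eq_zero_of_hasDerivAt_of_integrable
    (f := fun u : ℝ => Real.exp (ν * u - x * Real.cosh u))
    (f' := fun u : ℝ => Real.exp (ν * u - x * Real.cosh u) * (ν - x * Real.sinh u))
    (fun u => by
      have := (((hasDerivAt_id u).const_mul ν).sub ((Real.hasDerivAt_cosh u).const_mul x)).exp
      simpa using this)
    (by simp_rw [e]; exact i0.sub ((i1.sub i2).const_mul _)) (GG_int ν hx)
  simp_rw [e] at key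
  have i12 : Integrable (fun u : ℝ => x / 2 * (Real.exp ((ν + 1) * u - x * Real.cosh u) -
        Real.exp ((ν - 1) * u - x * Real.cosh u))) := (i1.sub i2).const_mul _
  rw [integral_sub i0 i12, integral_const_mul, integral_const_mul,
    integral_sub i1 i2] at key
  change ν * GG ν x - x / 2 * (GG (ν + 1) x - GG (ν - 1) x) = 0 at key
  field_simp
  linarith

lemma GG_neg (ν x : ℝ) : GG (-ν) x = GG ν x := by
  unfold GG
  rw [← integral_neg_eq_self]
  simp [Real.cosh_neg]

lemma GG_half {x : ℝ} (hx : 0 < x) : GG (1 / 2) x = 2 * Real.exp (-x) * √(π / (2 * x)) := by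
  have i1 := GG_int (1 / 2) hx
  have i2 := GG_int (-(1 / 2)) hx
  have h1 : GG (1 / 2) x + GG (-(1 / 2)) x =
      ∫ u : ℝ, 2 * Real.exp (-x) * (Real.cosh (2⁻¹ * u) * Real.exp (-(2 * x) * Real.sinh (2⁻¹ * u) ^ 2)) := by
    unfold GG
    rw [← integral_add i1 i2]
    congr 1
    ext u
    have h1 : Real.cosh u = 1 + 2 * Real.sinh (2⁻¹ * u) ^ 2 := by
      have := Real.cosh_two_mul (2⁻¹ * u)
      rw [Real.cosh_sq, mul_inv_cancel_left₀ (two_ne_zero)] at this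
      linarith
    rw [h1, Real.cosh_eq (2⁻¹ * u)]
    have e1 : 1 / 2 * u - x * (1 + 2 * Real.sinh (2⁻¹ * u) ^ 2) =
      -x + (2⁻¹ * u + -(2 * x) * Real.sinh (2⁻¹ * u) ^ 2) := by ring
    have e2 : -(1 / 2) * u - x * (1 + 2 * Real.sinh (2⁻¹ * u) ^ 2) =
      -x + (-(2⁻¹ * u) + -(2 * x) * Real.sinh (2⁻¹ * u) ^ 2) := by ring
    rw [e1, e2]
    simp only [Real.exp_add]
    ring
  rw [integral_const_mul, Measure.integral_comp_mul_left
    (fun y => Real.cosh y * Real.exp (-(2 * x) * Real.sinh y ^ 2))] at h1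
  have h2 := integral_image_eq_integral_abs_deriv_smul (s := Set.univ) MeasurableSet.univ
    (fun y _ => (Real.hasDerivAt_sinh y).hasDerivWithinAt) Real.sinh_injective.injOn
    (fun w => Real.exp (-(2 * x) * w ^ 2))
  rw [Set.image_univ, Real.sinh_surjective.range_eq] at h2
  simp only [Measure.restrict_univ, abs_of_pos (Real.cosh_pos _), smul_eq_mul] at h2
  rw [← h2, integral_gaussian, GG_neg] at h1
  simp only [inv_inv, abs_two, smul_eq_mul] at h1
  linarith

lemma integral_symm {h : ℝ → ℝ} (hi : Integrable h) :
    ∫ x, h x = ∫ x in Set.Ioi (0 : ℝ), (h x + h (-x)) := by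
  have h1 := integral_comp_abs (f := fun x => h x + h (-x))
  have h2 : ∀ x : ℝ, h |x| + h (-|x|) = h x + h (-x) := by
    intro x
    rcases abs_choice x with h | h <;> rw [h]
    rw [neg_neg, add_comm]
  simp only [h2] at h1
  rw [integral_add hi hi.comp_neg, integral_neg_eq_self h] at h1
  linarith

lemma besselK_eq_s13 (ν : ℝ) {w : ℝ} (hw : 0 < w) : besselK ν w = GG ν w / 2 := by
  unfold GG
  rw [integral_symm (GG_int ν hw), besselK, ← integral_div]
  congr 1
  ext u
  rw [Real.cosh_neg, Real.cosh_eq (ν * u), show ν * u - w * Real.cosh u = -w * Real.cosh u + ν * u by ring,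
    show ν * -u - w * Real.cosh u = -w * Real.cosh u + -(ν * u) by ring, Real.exp_add, Real.exp_add]
  ring

lemma F_eq_s13 (n : ℝ) {z : ℝ} (hz : 0 < z) :
    F 1 (2 * n) z = GG (n + 1 / 2) (z / 2) * GG (n - 1 / 2) (z / 2) / 8 := by
  have hz2 : 0 < z / 2 := by positivity
  set g : ℝ → ℝ := fun u => Real.exp ((n + 1 / 2) * u - z / 2 * Real.cosh u) with hg
  set k : ℝ → ℝ := fun u => Real.exp ((n - 1 / 2) * u - z / 2 * Real.cosh u) with hk
  have ig : Integrable g := GG_int _ hz2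
  have ik : Integrable k := GG_int _ hz2
  have inner : ∀ u : ℝ, ∫ t, g u * k (u - 2 * t) = g u * (GG (n - 1 / 2) (z / 2) / 2) := by
    intro u
    rw [integral_const_mul, Measure.integral_comp_mul_left (fun y => k (u - y)),
      integral_sub_left_eq_self k]
    change g u * (|(2 : ℝ)⁻¹| * GG (n - 1 / 2) (z / 2)) = _
    rw [abs_of_pos (by norm_num)]
    ring
  have iprod : Integrable (Function.uncurry fun u t : ℝ => g u * k (u - 2 * t))
      (volume.prod volume) := by
    rw [integrable_prod_iff (by
      apply Continuous.aestronglyMeasurable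
      simp only [Function.uncurry_def, hg, hk]
      fun_prop)]
    constructor
    · refine Filter.Eventually.of_forall fun u => ?_
      exact ((ik.comp_sub_left u).comp_mul_left' (two_ne_zero)).const_mul (g u)
    · have : ∀ u t : ℝ, ‖g u * k (u - 2 * t)‖ = g u * k (u - 2 * t) := fun u t => by
        rw [Real.norm_eq_abs, abs_of_pos (by positivity)]
      simp only [Function.uncurry_apply_pair, this, inner]
      exact ig.mul_const _
  have sec : ∀ t : ℝ, ∫ u, g u * k (u - 2 * t) = Real.exp t * GG (2 * n) (z * Real.cosh t) := by
    intro t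
    rw [← integral_add_right_eq_self _ t, GG, ← integral_const_mul]
    congr 1
    ext s
    simp only [hg, hk]
    rw [← Real.exp_add, ← Real.exp_add, show s + t - 2 * t = s - t by ring, Real.cosh_add,
      Real.cosh_sub]
    congr 1
    ring
  have it : Integrable fun t : ℝ => Real.exp t * GG (2 * n) (z * Real.cosh t) := by
    have := iprod.integral_prod_right
    simpa only [Function.uncurry_apply_pair, sec] using this
  have sw := integral_integral_swap iprod
  simp only [sec, inner] at sw
  rw [integral_mul_const, integral_symm it] at sw
  have : F 1 (2 * n) z = (∫ x in Set.Ioi (0 : ℝ), (Real.exp x * GG (2 * n) (z * Real.cosh x) +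
      Real.exp (-x) * GG (2 * n) (z * Real.cosh (-x)))) / 4 := by
    rw [F, ← integral_div]
    congr 1
    ext t
    rw [besselK_eq_s13 _ (mul_pos hz (Real.cosh_pos t)), Real.cosh_neg]
    nth_rewrite 1 [Real.cosh_eq t]
    ring
  rw [this, ← sw]
  simp only [hg, GG]
  ring

/-- Bessel polynomials (rescaled). -/
noncomputable def bp : ℕ → Polynomial ℝ
  | 0 => 1
  | 1 => 1 + Polynomial.C 2 * Polynomial.X
  | (m + 2) => bp m + Polynomial.C (2 * (2 * (m : ℝ) + 3)) * Polynomial.X * bp (m + 1)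

lemma GG_bp {z : ℝ} (hz : 0 < z) (m : ℕ) :
    GG ((m : ℝ) + 1 / 2) (z / 2) = 2 * Real.exp (-(z / 2)) * √(π / z) * (bp m).eval (1 / z) ∧
    GG (((m + 1 : ℕ) : ℝ) + 1 / 2) (z / 2) =
      2 * Real.exp (-(z / 2)) * √(π / z) * (bp (m + 1)).eval (1 / z) := by
  have hz2 : 0 < z / 2 := by positivity
  induction m with
  | zero =>
    have h0 := GG_half hz2
    have h1 := GG_rec (1 / 2) hz2
    rw [show (1 / 2 - 1 : ℝ) = -(1 / 2) by norm_num, GG_neg, h0] at h1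
    rw [show 2 * (z / 2) = z by ring] at h0 h1
    constructor
    · simpa [bp] using h0
    · rw [show (((0 + 1 : ℕ) : ℝ) + 1 / 2) = 1 / 2 + 1 by push_cast; ring, h1]
      simp [bp]
      field_simp
  | succ m ih =>
    refine ⟨ih.2, ?_⟩
    have h1 := GG_rec (((m + 1 : ℕ) : ℝ) + 1 / 2) hz2
    rw [ih.2, show (((m + 1 : ℕ) : ℝ) + 1 / 2 - 1) = m + 1 / 2 by push_cast; ring, ih.1] at h1
    rw [show (((m + 1 + 1 : ℕ) : ℝ) + 1 / 2) = ((m + 1 : ℕ) : ℝ) + 1 / 2 + 1 by push_cast; ring, h1]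
    simp [bp]
    field_simp
    ring

/-- `∏_{i<k} (2i+3)` -/
noncomputable def bb (k : ℕ) : ℝ := ∏ i ∈ Finset.range k, (2 * (i : ℝ) + 3)

lemma bb_succ (k : ℕ) : bb (k + 1) = bb k * (2 * (k : ℝ) + 3) := by
  simp [bb, Finset.prod_range_succ]

lemma bb_pos (k : ℕ) : 0 < bb k := Finset.prod_pos fun i _ => by positivity

open Polynomial in
lemma bp_shape (m : ℕ) : (bp m).degree < ((m + 1 : ℕ) : WithBot ℕ) ∧ ∃ Q : Polynomial ℝ, Q.degree < (m : WithBot ℕ) ∧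
    bp (m + 1) = C (2 ^ (m + 1) * bb m) * (X ^ (m + 1) + C (1 / 2) * X ^ m) + Q := by
  induction m with
  | zero =>
    refine ⟨?_, 0, ?_, ?_⟩
    · simp [bp]
    · simp
    · simp [bp, bb, mul_add, ← C_mul]
      ring
  | succ m ih =>
    obtain ⟨h1, Q, hQ, h2⟩ := ih
    refine ⟨?_, bp m + C (2 * (2 * (m : ℝ) + 3)) * X * Q, ?_, ?_⟩
    · rw [h2]
      rw [degree_lt_iff_coeff_zero] at hQ ⊢
      intro k hk
      have e1 : k ≠ m + 1 := by omega
      have e2 : k ≠ m := by omega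
      simp [coeff_X_pow, e1, e2, hQ k (by omega), mul_add, ← mul_assoc, ← C_mul, -map_mul, -map_pow]
    · rw [degree_lt_iff_coeff_zero] at hQ h1 ⊢
      intro k hk
      obtain ⟨j, rfl⟩ : ∃ j, k = j + 1 := ⟨k - 1, by omega⟩
      rw [coeff_add, h1 _ hk, mul_assoc, coeff_C_mul, coeff_X_mul, hQ j (by omega)]
      simp
    · rw [bp, h2, bb_succ]
      simp only [map_mul, map_pow, map_add]
      ring

open Polynomial in
lemma final_poly (k : ℕ) : ∃ R : Polynomial ℝ, R.natDegree ≤ 2 * k + 1 ∧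
    bp (k + 2) * bp (k + 1) = C (2 ^ (2 * k + 3) * bb (k + 1) * bb k) *
      (X ^ (2 * k + 3) + X ^ (2 * k + 2) + R) := by
  obtain ⟨-, Q, hQ, h⟩ := bp_shape (k + 1)
  obtain ⟨-, Q', hQ', h'⟩ := bp_shape k
  set A : ℝ := 2 ^ (k + 1 + 1) * bb (k + 1) with hA
  set B : ℝ := 2 ^ (k + 1) * bb k with hB
  have hA0 : A ≠ 0 := by have := bb_pos (k + 1); positivity
  have hB0 : B ≠ 0 := by have := bb_pos k; positivity
  have hAB : (2 ^ (2 * k + 3) * bb (k + 1) * bb k) = A * B := by rw [hA, hB]; ring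
  have cA : C A * C A⁻¹ = (1 : ℝ[X]) := by rw [← C_mul, mul_inv_cancel₀ hA0, C_1]
  have cB : C B * C B⁻¹ = (1 : ℝ[X]) := by rw [← C_mul, mul_inv_cancel₀ hB0, C_1]
  have c2 : C (1 / 2) + C (1 / 2) = (1 : ℝ[X]) := by rw [← C_add]; norm_num
  have dQ : Q.natDegree ≤ k := by
    rw [natDegree_le_iff_degree_le]
    rw [degree_le_iff_coeff_zero]
    rw [degree_lt_iff_coeff_zero] at hQ
    intro i hi
    exact hQ i (by exact_mod_cast hi)
  refine ⟨C (1 / 2) * C (1 / 2) * X ^ (2 * k + 1) + C B⁻¹ * ((X ^ (k + 2) + C (1 / 2) * X ^ (k + 1)) * Q')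
    + C A⁻¹ * (Q * (X ^ (k + 1) + C (1 / 2) * X ^ k)) + C A⁻¹ * C B⁻¹ * (Q * Q'), ?_, ?_⟩
  · have dQ' : Q' = 0 ∨ Q'.natDegree + 1 ≤ k := by
      by_cases h0 : Q' = 0
      · exact Or.inl h0
      · exact Or.inr ((natDegree_lt_iff_degree_lt h0).2 hQ')
    have p1 : (X ^ (k + 2) + C (1 / 2) * X ^ (k + 1) : ℝ[X]).natDegree ≤ k + 2 := by compute_degree!
    have p2 : (X ^ (k + 1) + C (1 / 2) * X ^ k : ℝ[X]).natDegree ≤ k + 1 := by compute_degree!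
    have a1 : ((X ^ (k + 2) + C (1 / 2) * X ^ (k + 1)) * Q').natDegree ≤ 2 * k + 1 := by
      rcases dQ' with h0 | h0
      · simp [h0]
      · exact natDegree_mul_le.trans (by omega)
    have a2 : (Q * (X ^ (k + 1) + C (1 / 2) * X ^ k)).natDegree ≤ 2 * k + 1 :=
      natDegree_mul_le.trans (by omega)
    have a3 : (Q * Q').natDegree ≤ 2 * k + 1 := by
      rcases dQ' with h0 | h0
      · simp [h0]
      · exact natDegree_mul_le.trans (by omega)
    refine natDegree_add_le_of_degree_le (natDegree_add_le_of_degree_le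
      (natDegree_add_le_of_degree_le ?_ ((natDegree_C_mul_le _ _).trans a1))
      ((natDegree_C_mul_le _ _).trans a2)) ?_
    · rw [← C_mul]; exact natDegree_C_mul_X_pow_le _ _
    · rw [← C_mul]; exact (natDegree_C_mul_le _ _).trans a3
  · rw [show k + 2 = k + 1 + 1 from rfl, h, h', hAB]
    clear_value A B
    rw [C_mul]
    generalize (C (1 / 2) : ℝ[X]) = c at *
    generalize (C A⁻¹ : ℝ[X]) = a' at *
    generalize (C B⁻¹ : ℝ[X]) = b' at *
    generalize (C A : ℝ[X]) = a at *
    generalize (C B : ℝ[X]) = b at *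
    linear_combination (a * b * X ^ (2 * k + 2)) * c2
      - (a * (X ^ (k + 2) + c * X ^ (k + 1)) * Q') * cB
      - (b * (Q * (X ^ (k + 1) + c * X ^ k))) * cA
      - (Q * Q') * (b * b' * cA + cB)

theorem F_one_even_leading_order (n : ℕ) (hn : 2 ≤ n) :
    ∃ R : Polynomial ℝ, R.natDegree ≤ 2 * n - 3 ∧
      ∀ z : ℝ, 0 < z →
        F 1 (2 * (n : ℝ)) z =
          (2 ^ (2 * n - 1) * π *
              (∏ j ∈ Finset.range (n - 1), (2 * ((n : ℝ) - (j + 1)) + 1)) ^ 2 /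
                (2 * (2 * (n : ℝ) - 1))) *
            z⁻¹ * Real.exp (-z) *
            (z ^ (-(2 * (n : ℝ) - 1)) + z ^ (-(2 * (n : ℝ) - 2)) + R.eval (1 / z)) := by
  obtain ⟨k, rfl⟩ : ∃ k, n = k + 2 := ⟨n - 2, by omega⟩
  obtain ⟨R, hR, hp⟩ := final_poly k
  refine ⟨R, by omega, fun z hz => ?_⟩
  have hprod : (∏ j ∈ Finset.range (k + 2 - 1), (2 * (((k + 2 : ℕ) : ℝ) - (j + 1)) + 1)) =
      bb (k + 1) := by
    rw [bb, ← Finset.prod_range_reflect]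
    refine Finset.prod_congr rfl fun j hj => ?_
    have hj' : j ≤ k := by simp at hj; omega
    rw [show k + 2 - 1 - 1 - j = k - j by omega, Nat.cast_sub hj']
    push_cast
    ring
  have e1 : z ^ (-(2 * ((k + 2 : ℕ) : ℝ) - 1)) = (1 / z) ^ (2 * k + 3) := by
    rw [Real.rpow_neg hz.le, one_div, inv_pow, ← Real.rpow_natCast]
    congr 2
    push_cast
    ring
  have e2 : z ^ (-(2 * ((k + 2 : ℕ) : ℝ) - 2)) = (1 / z) ^ (2 * k + 2) := by
    rw [Real.rpow_neg hz.le, one_div, inv_pow, ← Real.rpow_natCast]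
    congr 2
    push_cast
    ring
  rw [hprod, e1, e2, F_eq_s13 _ hz, show ((k + 2 : ℕ) : ℝ) - 1 / 2 = ((k + 1 : ℕ) : ℝ) + 1 / 2 by
    push_cast; ring, (GG_bp hz (k + 2)).1, (GG_bp hz (k + 1)).1]
  have hp' := congrArg (Polynomial.eval (1 / z)) hp
  simp only [Polynomial.eval_mul, Polynomial.eval_add, Polynomial.eval_pow, Polynomial.eval_C,
    Polynomial.eval_X] at hp'
  have hs : √(π / z) * √(π / z) = π / z := Real.mul_self_sqrt (by positivity)
  have he : Real.exp (-(z / 2)) * Real.exp (-(z / 2)) = Real.exp (-z) := by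
    rw [← Real.exp_add]; congr 1; ring
  have hk : (2 * ((k + 2 : ℕ) : ℝ) - 1) = 2 * k + 3 := by push_cast; ring
  have hk0 : (2 * (k : ℝ) + 3) ≠ 0 := by positivity
  rw [hk, show 2 * (k + 2) - 1 = 2 * k + 3 by omega]
  calc _ = (Real.exp (-(z / 2)) * Real.exp (-(z / 2))) * (√(π / z) * √(π / z)) *
        ((bp (k + 2)).eval (1 / z) * (bp (k + 1)).eval (1 / z)) / 2 := by ring
    _ = _ := by
      rw [hs, he, hp', bb_succ]
      generalize (1 / z) ^ (2 * k + 3) + (1 / z) ^ (2 * k + 2) + R.eval (1 / z) = S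
      field_simp
end

section
/- Let N and ν be nonnegative integers with N odd and ν even, or N even and ν odd. Then there exists a real polynomial Q_{N,ν} such that F_ν^N(z) = z^{−1}·e^{−z}·Q_{N,ν}(1/z) for all real z > 0, and the degrees satisfy: deg Q_{2m,2n+1} ≤ 2(n+m), deg Q_{2m+1,0} ≤ 2m, and deg Q_{2m+1,2n} ≤ 2(n+m)−1 for n > 0, for all nonnegative integers m and n. -/
open Real MeasureTheory

lemma lint_sinh (c : ℝ) (hc : 0 < c) (g : ℝ → ENNReal) :
    ∫⁻ s in Set.Ioi (0:ℝ), ENNReal.ofReal (c * Real.cosh s) * g (c * Real.sinh s)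
      = ∫⁻ q in Set.Ioi (0:ℝ), g q := by
  have himg : (fun s => c * Real.sinh s) '' Set.Ioi (0:ℝ) = Set.Ioi 0 := by
    ext q
    simp only [Set.mem_image, Set.mem_Ioi]
    constructor
    · rintro ⟨s, hs, rfl⟩
      exact mul_pos hc (Real.sinh_pos_iff.2 hs)
    · intro hq
      refine ⟨Real.arsinh (q / c), Real.arsinh_pos_iff.2 (div_pos hq hc), ?_⟩
      rw [Real.sinh_arsinh]
      field_simp
  have := lintegral_image_eq_lintegral_deriv_mul_of_monotoneOn (s := Set.Ioi (0:ℝ))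
    (f := fun s => c * Real.sinh s) (f' := fun s => c * Real.cosh s) measurableSet_Ioi
    (fun x _ => ((Real.hasDerivAt_sinh x).const_mul c).hasDerivWithinAt)
    (fun x _ y _ hxy => mul_le_mul_of_nonneg_left (Real.sinh_le_sinh.2 hxy) hc.le) g
  rw [himg] at this
  exact this.symm

lemma lint_sqrt (g : ℝ → ENNReal) :
    ∫⁻ r in Set.Ioi (0:ℝ), ENNReal.ofReal (r / √(1 + r ^ 2)) * g (√(1 + r ^ 2))
      = ∫⁻ q in Set.Ioi (1:ℝ), g q := by
  have himg : (fun r => √(1 + r ^ 2)) '' Set.Ioi (0:ℝ) = Set.Ioi 1 := by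
    ext q
    simp only [Set.mem_image, Set.mem_Ioi]
    constructor
    · rintro ⟨s, hs, rfl⟩
      rw [Real.lt_sqrt (by norm_num)]
      nlinarith
    · intro hq
      refine ⟨√(q ^ 2 - 1), Real.sqrt_pos.2 (by nlinarith), ?_⟩
      rw [Real.sq_sqrt (by nlinarith)]
      rw [show 1 + (q ^ 2 - 1) = q ^ 2 by ring, Real.sqrt_sq (by linarith)]
  have := lintegral_image_eq_lintegral_deriv_mul_of_monotoneOn (s := Set.Ioi (0:ℝ))
    (f := fun r => √(1 + r ^ 2)) (f' := fun r => r / √(1 + r ^ 2)) measurableSet_Ioi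
    (fun x _ => by
      have h1 : HasDerivAt (fun r : ℝ => 1 + r ^ 2) (2 * x) x := by
        simpa using (hasDerivAt_pow 2 x).const_add 1
      have h2 := h1.sqrt (by positivity)
      refine (h2.congr_deriv ?_).hasDerivWithinAt
      field_simp)
    (fun x hx y hy hxy => by
      have hx' : (0:ℝ) < x := hx
      apply Real.sqrt_le_sqrt
      gcongr) g
  rw [himg] at this
  exact this.symm

lemma lint_polar (f : ℝ × ℝ → ENNReal) (hf : Measurable f) :
    ∫⁻ p in Set.Ioi (0:ℝ), ∫⁻ q in Set.Ioi (0:ℝ), f (p, q) =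
    ∫⁻ r in Set.Ioi (0:ℝ), ∫⁻ θ in Set.Ioo (0:ℝ) (π / 2),
      ENNReal.ofReal r * f (r * Real.cos θ, r * Real.sin θ) := by
  have hS : MeasurableSet (Set.Ioi (0:ℝ) ×ˢ Set.Ioi (0:ℝ)) :=
    measurableSet_Ioi.prod measurableSet_Ioi
  have hT : MeasurableSet (Set.Ioi (0:ℝ) ×ˢ Set.Ioo (0:ℝ) (π / 2)) :=
    measurableSet_Ioi.prod measurableSet_Ioo
  have hm : Measurable (fun x : ℝ × ℝ =>
      ENNReal.ofReal x.1 * f (x.1 * Real.cos x.2, x.1 * Real.sin x.2)) := by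
    apply Measurable.mul (by fun_prop)
    exact hf.comp (by fun_prop)
  rw [← setLIntegral_prod (μ := volume) (ν := volume) f hf.aemeasurable,
    ← setLIntegral_prod (μ := volume) (ν := volume)
      (fun x : ℝ × ℝ => ENNReal.ofReal x.1 * f (x.1 * Real.cos x.2, x.1 * Real.sin x.2))
      hm.aemeasurable]
  rw [← lintegral_indicator hS, ← lintegral_indicator hT]
  have := lintegral_comp_polarCoord_symm
    ((Set.Ioi (0:ℝ) ×ˢ Set.Ioi (0:ℝ)).indicator f)
  rw [← Measure.volume_eq_prod, ← this, ← lintegral_indicator polarCoord.open_target.measurableSet]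
  congr 1
  ext ⟨r, θ⟩
  have hpi := Real.pi_pos
  by_cases hr : 0 < r
  · by_cases hθ : θ ∈ Set.Ioo (0:ℝ) (π / 2)
    · have hc : 0 < Real.cos θ := Real.cos_pos_of_mem_Ioo ⟨by linarith [hθ.1], hθ.2⟩
      have hs : 0 < Real.sin θ := Real.sin_pos_of_mem_Ioo ⟨hθ.1, by linarith [hθ.2]⟩
      rw [Set.indicator_of_mem, Set.indicator_of_mem, Set.indicator_of_mem]
      · simp [polarCoord_symm_apply]
      · exact ⟨hr, hθ⟩
      · exact ⟨mul_pos hr hc, mul_pos hr hs⟩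
      · exact ⟨hr, by linarith [hθ.1], by linarith [hθ.2]⟩
    · rw [Set.indicator_of_notMem (s := Set.Ioi (0:ℝ) ×ˢ Set.Ioo (0:ℝ) (π / 2))
        (fun h => hθ h.2)]
      by_cases ht : (r, θ) ∈ polarCoord.target
      · rw [Set.indicator_of_mem ht, Set.indicator_of_notMem, smul_zero]
        rintro ⟨h1, h2⟩
        apply hθ
        simp only [polarCoord_symm_apply, Set.mem_Ioi] at h1 h2
        have hc : 0 < Real.cos θ := (pos_iff_pos_of_mul_pos h1).1 hr
        have hs : 0 < Real.sin θ := (pos_iff_pos_of_mul_pos h2).1 hr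
        have ht2 : -π < θ ∧ θ < π := ht.2
        constructor
        · by_contra hneg
          have := Real.sin_nonpos_of_nonpos_of_neg_pi_le (not_lt.1 hneg) ht2.1.le
          linarith
        · by_contra hneg
          have := Real.cos_nonpos_of_pi_div_two_le_of_le (not_lt.1 hneg) (by linarith)
          linarith
      · rw [Set.indicator_of_notMem ht]
  · rw [Set.indicator_of_notMem (fun h => hr h.1), Set.indicator_of_notMem (fun h => hr h.1)]

lemma exp_pow_integrable (k : ℕ) (z : ℝ) (hz : 0 < z) :
    IntegrableOn (fun R : ℝ => R ^ k * Real.exp (-z * R)) (Set.Ioi 1) := by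
  have := integrableOn_rpow_mul_exp_neg_mul_rpow (s := (k:ℝ)) (p := 1) (b := z)
    (by have : (0:ℝ) ≤ k := by positivity
        linarith) one_pos hz
  simp only [Real.rpow_natCast, Real.rpow_one] at this
  exact this.mono_set (Set.Ioi_subset_Ioi zero_le_one)

lemma exp_pow_integral (k : ℕ) : ∃ Q : Polynomial ℝ, Q.natDegree ≤ k ∧
    ∀ z : ℝ, 0 < z → ∫ R in Set.Ioi (1:ℝ), R ^ k * Real.exp (-z * R)
      = z⁻¹ * Real.exp (-z) * Q.eval (1 / z) := by
  induction k with
  | zero =>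
    refine ⟨1, by simp, fun z hz => ?_⟩
    have := integral_exp_mul_Ioi (a := -z) (by linarith) 1
    simp only [pow_zero, one_mul]
    rw [this]
    simp
    field_simp
  | succ k ih =>
    obtain ⟨Q, hQ, hQ'⟩ := ih
    refine ⟨1 + Polynomial.C ((k:ℝ) + 1) * (Polynomial.X * Q), ?_, fun z hz => ?_⟩
    · refine (Polynomial.natDegree_add_le _ _).trans (max_le (by simp) ?_)
      refine (Polynomial.natDegree_C_mul_le _ _).trans ?_
      refine Polynomial.natDegree_mul_le.trans ?_
      have := Polynomial.natDegree_X_le (R := ℝ)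
      omega
    · have hi1 := exp_pow_integrable (k + 1) z hz
      have hi0 := exp_pow_integrable k z hz
      have key := integral_Ioi_of_hasDerivAt_of_tendsto' (a := 1) (m := 0)
        (f := fun R : ℝ => -z⁻¹ * (R ^ (k + 1) * Real.exp (-z * R)))
        (f' := fun R : ℝ => R ^ (k + 1) * Real.exp (-z * R)
          - (z⁻¹ * (k + 1)) * (R ^ k * Real.exp (-z * R)))
        (fun x _ => by
          have h1 : HasDerivAt (fun R : ℝ => R ^ (k + 1)) (((k:ℝ) + 1) * x ^ k) x := by
            simpa using hasDerivAt_pow (k + 1) x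
          have h2 : HasDerivAt (fun R : ℝ => Real.exp (-z * R)) (Real.exp (-z * x) * (-z)) x := by
            have : HasDerivAt (fun R : ℝ => -z * R) (-z) x := by
              simpa using (hasDerivAt_id x).const_mul (-z)
            exact this.exp
          refine ((h1.mul h2).const_mul (-z⁻¹)).congr_deriv ?_
          field_simp
          ring)
        (hi1.sub (hi0.const_mul _))
        (by
          have := tendsto_rpow_mul_exp_neg_mul_atTop_nhds_zero ((k + 1 : ℕ) : ℝ) z hz
          simp only [Real.rpow_natCast] at this
          simpa using this.const_mul (-z⁻¹))
      rw [integral_sub hi1 (hi0.const_mul _), integral_const_mul, hQ' z hz] at key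
      simp at key ⊢
      linear_combination key

lemma exp_poly_integral (p : Polynomial ℝ) : ∃ Q : Polynomial ℝ, Q.natDegree ≤ p.natDegree ∧
    ∀ z : ℝ, 0 < z → IntegrableOn (fun R => p.eval R * Real.exp (-z * R)) (Set.Ioi 1) ∧
      ∫ R in Set.Ioi (1:ℝ), p.eval R * Real.exp (-z * R)
      = z⁻¹ * Real.exp (-z) * Q.eval (1 / z) := by
  choose Q hQ hQ' using exp_pow_integral
  refine ⟨∑ i ∈ Finset.range (p.natDegree + 1), Polynomial.C (p.coeff i) * Q i, ?_, fun z hz => ?_⟩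
  · apply Polynomial.natDegree_sum_le_of_forall_le
    intro i hi
    refine (Polynomial.natDegree_C_mul_le _ _).trans ((hQ i).trans ?_)
    simp at hi; omega
  · have heq : (fun R : ℝ => p.eval R * Real.exp (-z * R)) = fun R =>
        ∑ i ∈ Finset.range (p.natDegree + 1), p.coeff i * (R ^ i * Real.exp (-z * R)) := by
      ext R
      rw [Polynomial.eval_eq_sum_range, Finset.sum_mul]
      simp only [mul_assoc]
    rw [heq]
    have hi : ∀ i ∈ Finset.range (p.natDegree + 1), IntegrableOn
        (fun R : ℝ => p.coeff i * (R ^ i * Real.exp (-z * R))) (Set.Ioi 1) :=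
      fun i _ => (exp_pow_integrable i z hz).const_mul _
    refine ⟨integrable_finsetSum _ hi, ?_⟩
    rw [integral_finsetSum _ hi, Polynomial.eval_finsetSum, Finset.mul_sum]
    refine Finset.sum_congr rfl fun i _ => ?_
    rw [integral_const_mul, hQ' i z hz]
    simp
    ring

lemma theta_poly (b k : ℕ) : ∃ p : Polynomial ℝ, p.natDegree ≤ b + 2 * k ∧
    ∀ R : ℝ, ∫ θ in Set.Ioo (0:ℝ) (π / 2), (1 + (R ^ 2 - 1) * Real.cos θ ^ 2) ^ k * R ^ b
      = p.eval R := by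
  refine ⟨∑ i ∈ Finset.range (k + 1), Polynomial.C ((∫ θ in Set.Ioo (0:ℝ) (π / 2),
    (Real.cos θ ^ 2) ^ i * (k.choose i : ℝ))) * ((Polynomial.X ^ 2 - 1) ^ i * Polynomial.X ^ b),
    ?_, fun R => ?_⟩
  · apply Polynomial.natDegree_sum_le_of_forall_le
    intro i hi
    refine (Polynomial.natDegree_C_mul_le _ _).trans ?_
    have h1 : ((Polynomial.X ^ 2 - 1 : Polynomial ℝ)).natDegree ≤ 2 := by
      compute_degree
    have h2 : ((Polynomial.X ^ 2 - 1 : Polynomial ℝ) ^ i).natDegree ≤ i * 2 :=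
      Polynomial.natDegree_pow_le_of_le i h1
    refine Polynomial.natDegree_mul_le.trans ?_
    rw [Polynomial.natDegree_X_pow]
    simp at hi; omega
  · have heq : (fun θ : ℝ => (1 + (R ^ 2 - 1) * Real.cos θ ^ 2) ^ k * R ^ b) = fun θ =>
        ∑ i ∈ Finset.range (k + 1),
          ((Real.cos θ ^ 2) ^ i * (k.choose i : ℝ)) * ((R ^ 2 - 1) ^ i * R ^ b) := by
      ext θ
      rw [add_comm, add_pow, Finset.sum_mul]
      refine Finset.sum_congr rfl fun i _ => ?_
      rw [mul_pow]; simp; ring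
    rw [heq, integral_finsetSum, Polynomial.eval_finsetSum]
    · refine Finset.sum_congr rfl fun i _ => ?_
      rw [integral_mul_const]
      simp
    · intro i _
      have : Continuous fun θ : ℝ =>
        ((Real.cos θ ^ 2) ^ i * (k.choose i : ℝ)) * ((R ^ 2 - 1) ^ i * R ^ b) := by fun_prop
      exact (this.integrableOn_Icc (a := 0) (b := π / 2)).mono_set Set.Ioo_subset_Icc_self

noncomputable def Gf (a b : ℕ) (z : ℝ) (x : ℝ × ℝ) : ℝ :=
  Real.cosh x.1 ^ a * Real.cosh x.2 ^ b * Real.exp (-z * (Real.cosh x.1 * Real.cosh x.2))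

lemma Gf_cont (a b : ℕ) (z : ℝ) : Continuous (Gf a b z) := by
  unfold Gf
  have := Real.continuous_cosh
  fun_prop

lemma Gf_nonneg (a b : ℕ) (z : ℝ) (x : ℝ × ℝ) : 0 ≤ Gf a b z x := by
  unfold Gf
  have h1 := Real.cosh_pos x.1
  have h2 := Real.cosh_pos x.2
  positivity

noncomputable def Hf (k b : ℕ) (z : ℝ) (x : ℝ × ℝ) : ℝ :=
  (1 + x.1 ^ 2) ^ k * √(1 + x.1 ^ 2 + x.2 ^ 2) ^ b *
    Real.exp (-z * √(1 + x.1 ^ 2 + x.2 ^ 2)) / √(1 + x.1 ^ 2 + x.2 ^ 2)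

lemma Hf_meas (k b : ℕ) (z : ℝ) : Measurable (Hf k b z) := by
  unfold Hf
  fun_prop

lemma GH (k b : ℕ) (z t s : ℝ) : Gf (b + 1 + 2 * k) b z (t, s) =
    Real.cosh t * ((Real.cosh t * Real.cosh s) *
      Hf k b z (Real.sinh t, Real.cosh t * Real.sinh s)) := by
  have h1 := Real.cosh_pos t
  have h2 := Real.cosh_pos s
  have hR : √(1 + Real.sinh t ^ 2 + (Real.cosh t * Real.sinh s) ^ 2)
      = Real.cosh t * Real.cosh s := by
    rw [Real.sqrt_eq_iff_mul_self_eq (by positivity) (by positivity)]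
    have e1 := Real.cosh_sq t
    have e2 := Real.cosh_sq s
    first | linear_combination (Real.cosh t) ^ 2 * e2 + e1 | linear_combination -(Real.cosh t) ^ 2 * e2 - e1
  unfold Gf Hf
  simp only
  rw [hR, show 1 + Real.sinh t ^ 2 = Real.cosh t ^ 2 by rw [Real.cosh_sq]; ring]
  field_simp
  ring

lemma lint_GH (k b : ℕ) (z : ℝ) :
    ∫⁻ t in Set.Ioi (0:ℝ), ∫⁻ s in Set.Ioi (0:ℝ), ENNReal.ofReal (Gf (b + 1 + 2 * k) b z (t, s))
    = ∫⁻ p in Set.Ioi (0:ℝ), ∫⁻ q in Set.Ioi (0:ℝ), ENNReal.ofReal (Hf k b z (p, q)) := by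
  rw [← lint_sinh 1 one_pos (fun p => ∫⁻ q in Set.Ioi (0:ℝ), ENNReal.ofReal (Hf k b z (p, q)))]
  refine lintegral_congr fun t => ?_
  have h1 := Real.cosh_pos t
  rw [one_mul, one_mul, ← lint_sinh (Real.cosh t) h1 (fun q => ENNReal.ofReal (Hf k b z (Real.sinh t, q))),
    ← lintegral_const_mul' _ _ ENNReal.ofReal_ne_top]
  refine lintegral_congr fun s => ?_
  have h2 := Real.cosh_pos s
  rw [GH, ENNReal.ofReal_mul h1.le, ENNReal.ofReal_mul (mul_pos h1 h2).le]

lemma lint_main (k b : ℕ) : ∃ Q : Polynomial ℝ, Q.natDegree ≤ b + 2 * k ∧ ∀ z : ℝ, 0 < z →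
    0 ≤ z⁻¹ * Real.exp (-z) * Q.eval (1 / z) ∧
    ∫⁻ t in Set.Ioi (0:ℝ), ∫⁻ s in Set.Ioi (0:ℝ), ENNReal.ofReal (Gf (b + 1 + 2 * k) b z (t, s))
    = ENNReal.ofReal (z⁻¹ * Real.exp (-z) * Q.eval (1 / z)) := by
  obtain ⟨p, hp, hp'⟩ := theta_poly b k
  obtain ⟨Q, hQ, hQ'⟩ := exp_poly_integral p
  refine ⟨Q, hQ.trans hp, fun z hz => ?_⟩
  obtain ⟨hint, hval⟩ := hQ' z hz
  have hnn0 : ∀ R : ℝ, 1 < R → ∀ θ : ℝ, 0 ≤ (1 + (R ^ 2 - 1) * Real.cos θ ^ 2) ^ k * R ^ b := by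
    intro R hR θ
    have : 0 ≤ R ^ 2 - 1 := by nlinarith
    positivity
  have hnn : ∀ R : ℝ, 1 < R → 0 ≤ p.eval R * Real.exp (-z * R) := by
    intro R hR
    rw [← hp' R]
    exact mul_nonneg (integral_nonneg (hnn0 R hR)) (Real.exp_pos _).le
  refine ⟨?_, ?_⟩
  · rw [← hval]
    exact setIntegral_nonneg measurableSet_Ioi hnn
  rw [lint_GH, lint_polar (fun x => ENNReal.ofReal (Hf k b z x))
    (ENNReal.measurable_ofReal.comp (Hf_meas k b z)), ← hval,
    ofReal_integral_eq_lintegral_ofReal hint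
      ((ae_restrict_iff' measurableSet_Ioi).2 (Filter.Eventually.of_forall hnn)),
    ← lint_sqrt]
  refine setLIntegral_congr_fun measurableSet_Ioi fun r hr => ?_
  have hr' : (0:ℝ) < r := hr
  have hR1 : 1 < √(1 + r ^ 2) := by
    rw [Real.lt_sqrt (by norm_num)]
    nlinarith
  have hsq : √(1 + r ^ 2) ^ 2 = 1 + r ^ 2 := Real.sq_sqrt (by positivity)
  rw [← hp', ← integral_mul_const, ofReal_integral_eq_lintegral_ofReal,
    ← lintegral_const_mul' _ _ ENNReal.ofReal_ne_top]
  · refine lintegral_congr fun θ => ?_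
    rw [← ENNReal.ofReal_mul hr'.le, ← ENNReal.ofReal_mul (by positivity)]
    congr 1
    unfold Hf
    simp only
    rw [show 1 + (r * Real.cos θ) ^ 2 + (r * Real.sin θ) ^ 2 = 1 + r ^ 2 by
      linear_combination r ^ 2 * Real.sin_sq_add_cos_sq θ, hsq]
    ring
  · have : Continuous fun θ : ℝ => (1 + (√(1 + r ^ 2) ^ 2 - 1) * Real.cos θ ^ 2) ^ k
        * √(1 + r ^ 2) ^ b * Real.exp (-z * √(1 + r ^ 2)) := by fun_prop
    exact (this.integrableOn_Icc (a := 0) (b := π / 2)).mono_set Set.Ioo_subset_Icc_self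
  · exact Filter.Eventually.of_forall fun θ =>
      mul_nonneg (hnn0 _ hR1 θ) (Real.exp_pos _).le

lemma G_gt (k b : ℕ) : ∃ Q : Polynomial ℝ, Q.natDegree ≤ b + 2 * k ∧ ∀ z : ℝ, 0 < z →
    Integrable (Gf (b + 1 + 2 * k) b z)
      ((volume.restrict (Set.Ioi (0:ℝ))).prod (volume.restrict (Set.Ioi (0:ℝ)))) ∧
    ∫ x, Gf (b + 1 + 2 * k) b z x
      ∂((volume.restrict (Set.Ioi (0:ℝ))).prod (volume.restrict (Set.Ioi (0:ℝ))))
    = z⁻¹ * Real.exp (-z) * Q.eval (1 / z) := by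
  obtain ⟨Q, hQ, hQ'⟩ := lint_main k b
  refine ⟨Q, hQ, fun z hz => ?_⟩
  obtain ⟨h0, h1⟩ := hQ' z hz
  have hm : Measurable fun x => ENNReal.ofReal (Gf (b + 1 + 2 * k) b z x) :=
    ENNReal.measurable_ofReal.comp (Gf_cont _ _ z).measurable
  rw [← lintegral_prod _ hm.aemeasurable] at h1
  have hnn := fun x => Gf_nonneg (b + 1 + 2 * k) b z x
  refine ⟨⟨(Gf_cont _ _ z).aestronglyMeasurable, ?_⟩, ?_⟩
  · rw [hasFiniteIntegral_iff_ofReal (Filter.Eventually.of_forall hnn), h1]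
    exact ENNReal.ofReal_lt_top
  · rw [integral_eq_lintegral_of_nonneg_ae (Filter.Eventually.of_forall hnn)
      (Gf_cont _ _ z).aestronglyMeasurable, h1, ENNReal.toReal_ofReal h0]

lemma G_all (a b : ℕ) (hab : Odd (a + b)) : ∃ Q : Polynomial ℝ, Q.natDegree ≤ max a b - 1 ∧
    ∀ z : ℝ, 0 < z →
    Integrable (Gf a b z)
      ((volume.restrict (Set.Ioi (0:ℝ))).prod (volume.restrict (Set.Ioi (0:ℝ)))) ∧
    ∫ x, Gf a b z x
      ∂((volume.restrict (Set.Ioi (0:ℝ))).prod (volume.restrict (Set.Ioi (0:ℝ))))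
    = z⁻¹ * Real.exp (-z) * Q.eval (1 / z) := by
  obtain ⟨j, hj⟩ := hab
  rcases lt_or_ge b a with h | h
  · obtain ⟨k, rfl⟩ : ∃ k, a = b + 1 + 2 * k := ⟨j - b, by omega⟩
    obtain ⟨Q, hQ, hQ'⟩ := G_gt k b
    exact ⟨Q, by omega, hQ'⟩
  · obtain ⟨k, rfl⟩ : ∃ k, b = a + 1 + 2 * k := ⟨j - a, by omega⟩
    obtain ⟨Q, hQ, hQ'⟩ := G_gt k a
    refine ⟨Q, by omega, fun z hz => ?_⟩
    have hsw : Gf a (a + 1 + 2 * k) z = fun x => Gf (a + 1 + 2 * k) a z x.swap := by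
      ext x
      simp only [Gf, Prod.fst_swap, Prod.snd_swap]
      rw [mul_comm (Real.cosh x.1) (Real.cosh x.2), mul_comm (Real.cosh x.1 ^ a)]
    obtain ⟨h1, h2⟩ := hQ' z hz
    rw [hsw]
    exact ⟨h1.swap, by rw [integral_prod_swap, h2]⟩

lemma cosh_expand (n : ℕ) :
    (∃ p : Polynomial ℝ, p.natDegree ≤ n ∧
      ∀ s : ℝ, Real.cosh (((2 * n : ℕ) : ℝ) * s) = p.eval (Real.cosh s ^ 2)) ∧
    (∃ q : Polynomial ℝ, q.natDegree ≤ n ∧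
      ∀ s : ℝ, Real.cosh (((2 * n + 1 : ℕ) : ℝ) * s)
        = Real.cosh s * q.eval (Real.cosh s ^ 2)) := by
  have step : ∀ (m : ℕ) (s : ℝ), Real.cosh (((m + 2 : ℕ) : ℝ) * s) =
      2 * Real.cosh s * Real.cosh (((m + 1 : ℕ) : ℝ) * s) - Real.cosh ((m : ℝ) * s) := by
    intro m s
    have e1 : ((m + 2 : ℕ) : ℝ) * s = ((m + 1 : ℕ) : ℝ) * s + s := by push_cast; ring
    have e2 : (m : ℝ) * s = ((m + 1 : ℕ) : ℝ) * s - s := by push_cast; ring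
    rw [e1, e2, Real.cosh_add, Real.cosh_sub]
    ring
  induction n with
  | zero => exact ⟨⟨1, by simp, by simp⟩, ⟨1, by simp, by simp⟩⟩
  | succ n ih =>
    obtain ⟨⟨p, hp, hp'⟩, ⟨q, hq, hq'⟩⟩ := ih
    have hd : (2 * (Polynomial.X * q) - p).natDegree ≤ n + 1 := by
      refine (Polynomial.natDegree_sub_le _ _).trans (max_le ?_ (by omega))
      rw [show (2 : Polynomial ℝ) = Polynomial.C 2 from rfl]
      refine (Polynomial.natDegree_C_mul_le _ _).trans ?_
      refine Polynomial.natDegree_mul_le.trans ?_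
      have := Polynomial.natDegree_X_le (R := ℝ)
      omega
    have hv : ∀ s : ℝ, Real.cosh (((2 * (n + 1) : ℕ) : ℝ) * s)
        = (2 * (Polynomial.X * q) - p).eval (Real.cosh s ^ 2) := by
      intro s
      rw [show 2 * (n + 1) = 2 * n + 2 by ring, step, hq', hp']
      simp
      ring
    refine ⟨⟨_, hd, hv⟩, ⟨2 * (2 * (Polynomial.X * q) - p) - q, ?_, ?_⟩⟩
    · refine (Polynomial.natDegree_sub_le _ _).trans (max_le ?_ (by omega))
      rw [show (2 : Polynomial ℝ) * (2 * (Polynomial.X * q) - p)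
        = Polynomial.C 2 * (2 * (Polynomial.X * q) - p) from rfl]
      exact (Polynomial.natDegree_C_mul_le _ _).trans hd
    · intro s
      rw [show 2 * (n + 1) + 1 = 2 * n + 1 + 2 by ring, step,
        show 2 * n + 1 + 1 = 2 * (n + 1) by ring, hv, hq', Polynomial.eval_sub]
      simp
      ring

lemma cosh_sum (ν : ℕ) : ∃ (c : ℕ → ℝ) (e n : ℕ), 2 * n + e = ν ∧
    ∀ s : ℝ, Real.cosh ((ν : ℝ) * s)
      = ∑ i ∈ Finset.range (n + 1), c i * Real.cosh s ^ (2 * i + e) := by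
  rcases Nat.even_or_odd' ν with ⟨n, rfl | rfl⟩
  · obtain ⟨⟨p, hp, hp'⟩, -⟩ := cosh_expand n
    refine ⟨p.coeff, 0, n, rfl, fun s => ?_⟩
    rw [hp', Polynomial.eval_eq_sum_range' (Nat.lt_succ_of_le hp)]
    simp [pow_mul]
  · obtain ⟨-, ⟨p, hp, hp'⟩⟩ := cosh_expand n
    refine ⟨p.coeff, 1, n, rfl, fun s => ?_⟩
    rw [hp', Polynomial.eval_eq_sum_range' (Nat.lt_succ_of_le hp), Finset.mul_sum]
    refine Finset.sum_congr rfl fun i _ => ?_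
    rw [← pow_mul]
    ring

lemma F_max (N ν : ℕ) (h : Odd (N + ν)) : ∃ Q : Polynomial ℝ, Q.natDegree ≤ max N ν - 1 ∧
    ∀ z : ℝ, 0 < z → F N (ν : ℝ) z = z⁻¹ * Real.exp (-z) * Q.eval (1 / z) := by
  obtain ⟨c, e, n, hn, hc⟩ := cosh_sum ν
  have hodd : ∀ i, Odd (N + (2 * i + e)) := by
    intro i
    obtain ⟨j, hj⟩ := h
    rw [Nat.odd_iff]
    omega
  choose Q hQ hQ' using fun i => G_all N (2 * i + e) (hodd i)
  refine ⟨∑ i ∈ Finset.range (n + 1), Polynomial.C (c i) * Q i, ?_, fun z hz => ?_⟩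
  · apply Polynomial.natDegree_sum_le_of_forall_le
    intro i hi
    refine (Polynomial.natDegree_C_mul_le _ _).trans ((hQ i).trans ?_)
    simp at hi; omega
  · have hi : ∀ i ∈ Finset.range (n + 1), Integrable (fun x => c i * Gf N (2 * i + e) z x)
        ((volume.restrict (Set.Ioi (0:ℝ))).prod (volume.restrict (Set.Ioi (0:ℝ)))) :=
      fun i _ => (hQ' i z hz).1.const_mul _
    have hF : F N (ν : ℝ) z = ∫ t in Set.Ioi (0:ℝ), ∫ s in Set.Ioi (0:ℝ),
        ∑ i ∈ Finset.range (n + 1), c i * Gf N (2 * i + e) z (t, s) := by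
      unfold F besselK
      congr 1
      ext t
      rw [← integral_const_mul]
      congr 1
      ext s
      rw [hc s, Finset.mul_sum, Finset.mul_sum]
      refine Finset.sum_congr rfl fun i _ => ?_
      unfold Gf
      simp only
      rw [show -(z * Real.cosh t) * Real.cosh s = -z * (Real.cosh t * Real.cosh s) by ring]
      ring
    rw [hF, ← integral_prod
      (fun x : ℝ × ℝ => ∑ i ∈ Finset.range (n + 1), c i * Gf N (2 * i + e) z x)
      (integrable_finsetSum _ hi), integral_finsetSum _ hi, Polynomial.eval_finsetSum,
      Finset.mul_sum]
    refine Finset.sum_congr rfl fun i _ => ?_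
    rw [integral_const_mul, (hQ' i z hz).2]
    simp
    ring


theorem F_polynomial_form (N ν : ℕ)
    (h : (Odd N ∧ Even ν) ∨ (Even N ∧ Odd ν)) :
    ∃ Q : Polynomial ℝ,
      (∀ z : ℝ, 0 < z → F N (ν : ℝ) z = z⁻¹ * Real.exp (-z) * Q.eval (1 / z)) ∧
      ∀ m n : ℕ,
        (N = 2 * m ∧ ν = 2 * n + 1 → Q.natDegree ≤ 2 * (n + m)) ∧
        (N = 2 * m + 1 ∧ ν = 0 → Q.natDegree ≤ 2 * m) ∧
        (N = 2 * m + 1 ∧ ν = 2 * n ∧ 0 < n → Q.natDegree ≤ 2 * (n + m) - 1) := by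

  have hodd : Odd (N + ν) := by
    rcases h with ⟨h1, h2⟩ | ⟨h1, h2⟩
    · exact h1.add_even h2
    · exact h1.add_odd h2
  obtain ⟨Q, hQ, hQ'⟩ := F_max N ν hodd
  refine ⟨Q, hQ', fun m n => ⟨?_, ?_, ?_⟩⟩
  · rintro ⟨rfl, rfl⟩
    omega
  · rintro ⟨rfl, rfl⟩
    omega
  · rintro ⟨rfl, rfl, hn⟩
    omega
end

section
/- Let N and ν be nonnegative integers with N odd and ν even, or N even and ν odd. Then there exists a real polynomial P such that G_ν^N(z) = z^{−2}·e^{−z}·P(1/z) for all real z > 0, and deg P ≤ M_{N+2,ν} − 1, where M_{N+2,ν} = ν−1 if N+2 < ν and M_{N+2,ν} = N+1 if N+2 > ν. -/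
open Real MeasureTheory

/-- `G_ν^N(z) = ∫_0^∞ cosh^N(t) K_ν(z cosh t) sinh²(t) dt`. -/
noncomputable def G (N : ℕ) (ν : ℝ) (z : ℝ) : ℝ :=
  ∫ t in Set.Ioi (0 : ℝ),
    Real.cosh t ^ N * besselK ν (z * Real.cosh t) * Real.sinh t ^ 2

open Polynomial in
lemma aux_moment (a b : Polynomial ℝ) (ha : a.natDegree ≤ 2) (hb : b.natDegree ≤ 2) (k : ℕ) :
    ∀ l : ℕ, ∃ P : Polynomial ℝ, P.natDegree ≤ 2 * k ∧ ∀ ρ : ℝ,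
      P.eval ρ = ∫ x in (0:ℝ)..1, (a.eval ρ + b.eval ρ * x ^ 2) ^ k * x ^ l * √(1 - x ^ 2) := by
  induction k with
  | zero =>
    intro l
    exact ⟨C (∫ x in (0:ℝ)..1, x ^ l * √(1 - x ^ 2)), by simp, by simp⟩
  | succ k ih =>
    intro l
    obtain ⟨P, hP, hP'⟩ := ih l
    obtain ⟨Q, hQ, hQ'⟩ := ih (l + 2)
    refine ⟨a * P + b * Q, ?_, fun ρ => ?_⟩
    · refine (natDegree_add_le _ _).trans (max_le ?_ ?_)
      · exact natDegree_mul_le.trans (by omega)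
      · exact natDegree_mul_le.trans (by omega)
    · rw [eval_add, eval_mul, eval_mul, hP', hQ', ← intervalIntegral.integral_const_mul,
        ← intervalIntegral.integral_const_mul, ← intervalIntegral.integral_add]
      · congr 1; ext x; ring
      · apply Continuous.intervalIntegrable; fun_prop
      · apply Continuous.intervalIntegrable; fun_prop

lemma aux_cosh_le {ρ : ℝ} (hρ : 1 < ρ) {s : ℝ} (hs : s ∈ Set.Icc 0 (arcosh ρ)) : cosh s ≤ ρ := by
  have := (Real.cosh_le_cosh (x := s) (y := arcosh ρ)).2
    (by rw [abs_of_nonneg hs.1, abs_of_nonneg (arcosh_nonneg hρ.le)]; exact hs.2)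
  rwa [cosh_arcosh hρ.le] at this

lemma aux_pos (k : ℕ) {ρ : ℝ} (hρ : 1 < ρ) :
    ∫ s in (0:ℝ)..arcosh ρ, cosh s ^ (2 * k + 1) * √(ρ ^ 2 - cosh s ^ 2) =
      (ρ ^ 2 - 1) * ∫ x in (0:ℝ)..1, (1 + (ρ ^ 2 - 1) * x ^ 2) ^ k * √(1 - x ^ 2) := by
  have h2 : 0 < ρ ^ 2 - 1 := by nlinarith
  obtain ⟨r, hr, hrr⟩ : ∃ r : ℝ, 0 < r ∧ r ^ 2 = ρ ^ 2 - 1 :=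
    ⟨√(ρ ^ 2 - 1), by positivity, Real.sq_sqrt h2.le⟩
  have key := intervalIntegral.integral_comp_mul_deriv (a := 0) (b := arcosh ρ)
    (f := fun s => sinh s / r) (f' := fun s => cosh s / r)
    (g := fun x => (1 + (ρ ^ 2 - 1) * x ^ 2) ^ k * √(1 - x ^ 2))
    (fun x _ => (Real.hasDerivAt_sinh x).div_const r) (by fun_prop) (by fun_prop)
  have e1 : sinh (arcosh ρ) / r = 1 := by
    rw [sinh_arcosh hρ.le, ← hrr, Real.sqrt_sq hr.le, div_self hr.ne']
  simp only [e1, sinh_zero, zero_div] at key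
  rw [← key, ← intervalIntegral.integral_const_mul]
  congr 1; ext s
  have hc := Real.cosh_sq s
  have e2 : √(1 - (sinh s / r) ^ 2) = √(ρ ^ 2 - cosh s ^ 2) / r := by
    rw [← Real.sqrt_sq hr.le, ← Real.sqrt_div' _ (by positivity), Real.sqrt_sq hr.le]
    congr 1
    field_simp
    rw [hc, hrr]; ring
  have e3 : 1 + (ρ ^ 2 - 1) * (sinh s / r) ^ 2 = cosh s ^ 2 := by
    rw [← hrr, hc]; field_simp; ring
  simp only [Function.comp]
  rw [e2, e3, ← hrr]
  field_simp
  ring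

lemma aux_neg (k : ℕ) {ρ : ℝ} (hρ : 1 < ρ) :
    ρ ^ (2 * k + 1) * ∫ s in (0:ℝ)..arcosh ρ, √(ρ ^ 2 - cosh s ^ 2) / cosh s ^ (2 * k + 3) =
      (ρ ^ 2 - 1) * ∫ x in (0:ℝ)..1, (ρ ^ 2 + (1 - ρ ^ 2) * x ^ 2) ^ k * √(1 - x ^ 2) := by
  have h2 : 0 < ρ ^ 2 - 1 := by nlinarith
  have hρ0 : 0 < ρ := by linarith
  obtain ⟨r, hr, hrr⟩ : ∃ r : ℝ, 0 < r ∧ r ^ 2 = ρ ^ 2 - 1 :=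
    ⟨√(ρ ^ 2 - 1), by positivity, Real.sq_sqrt h2.le⟩
  have hcne : ∀ x, cosh x ≠ 0 := fun x => (cosh_pos x).ne'
  have key := intervalIntegral.integral_comp_mul_deriv (a := 0) (b := arcosh ρ)
    (f := fun s => ρ / r * (sinh s / cosh s)) (f' := fun s => ρ / r * ((cosh s * cosh s - sinh s * sinh s) / cosh s ^ 2))
    (g := fun x => (ρ ^ 2 + (1 - ρ ^ 2) * x ^ 2) ^ k * √(1 - x ^ 2))
    (fun x _ => (((Real.hasDerivAt_sinh x).div (Real.hasDerivAt_cosh x) (hcne x)).const_mul (ρ / r)))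
    (by
      apply Continuous.continuousOn
      have : ∀ x, cosh x ^ 2 ≠ 0 := fun x => pow_ne_zero _ (hcne x)
      fun_prop (disch := assumption)) (by fun_prop)
  have e1 : ρ / r * (sinh (arcosh ρ) / cosh (arcosh ρ)) = 1 := by
    rw [sinh_arcosh hρ.le, cosh_arcosh hρ.le, ← hrr, Real.sqrt_sq hr.le]; field_simp
  simp only [e1, sinh_zero, zero_div, mul_zero] at key
  rw [← key, ← intervalIntegral.integral_const_mul, ← intervalIntegral.integral_const_mul]
  congr 1; ext s
  have hc := Real.cosh_sq s
  have hcp := cosh_pos s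
  have e2 : √(1 - (ρ / r * (sinh s / cosh s)) ^ 2) = √(ρ ^ 2 - cosh s ^ 2) / (r * cosh s) := by
    have hrc : 0 ≤ r * cosh s := by positivity
    conv_rhs => rw [← Real.sqrt_sq hrc, ← Real.sqrt_div' _ (by positivity)]
    congr 1
    field_simp
    rw [hrr, show sinh s ^ 2 = cosh s ^ 2 - 1 by linarith]; ring
  have e3 : ρ ^ 2 + (1 - ρ ^ 2) * (ρ / r * (sinh s / cosh s)) ^ 2 = (ρ / cosh s) ^ 2 := by
    rw [show 1 - ρ ^ 2 = - r ^ 2 by linarith]; field_simp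
    rw [hc]; ring
  simp only [Function.comp]
  rw [e2, e3, ← hrr, show cosh s * cosh s - sinh s * sinh s = 1 by nlinarith, ← pow_mul, div_pow]
  field_simp
  ring

lemma aux_mid {ρ : ℝ} (hρ : 1 < ρ) :
    ∫ s in (0:ℝ)..arcosh ρ, √(ρ ^ 2 - cosh s ^ 2) / cosh s = π / 2 * (ρ - 1) := by
  have h2 : 0 < ρ ^ 2 - 1 := by nlinarith
  have hρ0 : 0 < ρ := by linarith
  obtain ⟨r, hr, hrr⟩ : ∃ r : ℝ, 0 < r ∧ r ^ 2 = ρ ^ 2 - 1 :=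
    ⟨√(ρ ^ 2 - 1), by positivity, Real.sq_sqrt h2.le⟩
  have hcne : ∀ x, cosh x ≠ 0 := fun x => (cosh_pos x).ne'
  have key := intervalIntegral.integral_eq_sub_of_hasDerivAt_of_le (a := 0) (b := arcosh ρ)
    (f := fun s => ρ * arcsin (ρ / r * (sinh s / cosh s)) - arcsin (sinh s / r))
    (f' := fun s => √(ρ ^ 2 - cosh s ^ 2) / cosh s) (arcosh_nonneg hρ.le)
    (by
      apply Continuous.continuousOn
      have : Continuous fun s => sinh s / cosh s := by fun_prop (disch := assumption)
      have h3 := Real.continuous_arcsin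
      fun_prop) ?_
    (by
      apply Continuous.intervalIntegrable
      fun_prop (disch := assumption))
  · rw [key]
    have e1 : ρ / r * (sinh (arcosh ρ) / cosh (arcosh ρ)) = 1 := by
      rw [sinh_arcosh hρ.le, cosh_arcosh hρ.le, ← hrr, Real.sqrt_sq hr.le]; field_simp
    have e1' : sinh (arcosh ρ) / r = 1 := by
      rw [sinh_arcosh hρ.le, ← hrr, Real.sqrt_sq hr.le, div_self hr.ne']
    simp only [e1, e1']
    simp
    ring
  · intro s hs
    have hc := Real.cosh_sq s
    have hcp := cosh_pos s
    have hlt : cosh s < ρ := by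
      have := (Real.cosh_lt_cosh (x := s) (y := arcosh ρ)).2
        (by rw [abs_of_nonneg hs.1.le, abs_of_nonneg (arcosh_nonneg hρ.le)]; exact hs.2)
      rwa [cosh_arcosh hρ.le] at this
    have hQ : 0 < ρ ^ 2 - cosh s ^ 2 := by nlinarith
    have q2 : 1 - (sinh s / r) ^ 2 = (ρ ^ 2 - cosh s ^ 2) / r ^ 2 := by
      field_simp
      rw [hc, hrr]; ring
    have p2 : 1 - (ρ / r * (sinh s / cosh s)) ^ 2 = (ρ ^ 2 - cosh s ^ 2) / (r * cosh s) ^ 2 := by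
      field_simp
      rw [hrr, show sinh s ^ 2 = cosh s ^ 2 - 1 by linarith]; ring
    have q2' : 0 < 1 - (sinh s / r) ^ 2 := by rw [q2]; positivity
    have p2' : 0 < 1 - (ρ / r * (sinh s / cosh s)) ^ 2 := by rw [p2]; positivity
    have d1 := (Real.hasDerivAt_arcsin (x := ρ / r * (sinh s / cosh s))
      (by intro h; rw [h] at p2'; norm_num at p2') (by intro h; rw [h] at p2'; norm_num at p2')).comp s
      (((Real.hasDerivAt_sinh s).div (Real.hasDerivAt_cosh s) (hcne s)).const_mul (ρ / r))
    have d2 := (Real.hasDerivAt_arcsin (x := sinh s / r)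
      (by intro h; rw [h] at q2'; norm_num at q2') (by intro h; rw [h] at q2'; norm_num at q2')).comp s
      ((Real.hasDerivAt_sinh s).div_const r)
    refine ((d1.const_mul ρ).sub d2).congr_deriv ?_
    rw [p2, q2, Real.sqrt_div hQ.le, Real.sqrt_div hQ.le, Real.sqrt_sq hr.le,
      Real.sqrt_sq (by positivity), show cosh s * cosh s - sinh s * sinh s = 1 by nlinarith]
    have hS : 0 < √(ρ ^ 2 - cosh s ^ 2) := Real.sqrt_pos.2 hQ
    have hS2 := Real.sq_sqrt hQ.le
    field_simp
    rw [hS2]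

open Polynomial in
lemma aux_base (N j : ℕ) (h : Odd (N + j)) :
    ∃ R : Polynomial ℝ, R.natDegree ≤ max (N + 1) (j - 1) ∧ R.eval 1 = 0 ∧ ∀ ρ : ℝ, 1 < ρ →
      R.eval ρ = ρ ^ N * ∫ s in (0:ℝ)..arcosh ρ,
        cosh s ^ j / cosh s ^ (N + 2) * √(ρ ^ 2 - cosh s ^ 2) := by
  have hcne : ∀ x, cosh x ≠ 0 := fun x => (cosh_pos x).ne'
  have hd : (X ^ 2 - 1 : ℝ[X]).natDegree ≤ 2 := by compute_degree
  have hd' : (1 - X ^ 2 : ℝ[X]).natDegree ≤ 2 := by compute_degree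
  rcases lt_trichotomy j (N + 1) with hj | hj | hj
  · obtain ⟨k, hk⟩ : ∃ k, N = j + 2 * k + 1 := by
      obtain ⟨m, hm⟩ := h; exact ⟨m - j, by omega⟩
    obtain ⟨P, hP, hP'⟩ := aux_moment (X ^ 2) (1 - X ^ 2) (by simp) hd' k 0
    refine ⟨X ^ j * ((X ^ 2 - 1) * P), ?_, by simp, fun ρ hρ => ?_⟩
    · refine natDegree_mul_le.trans ?_
      have := natDegree_mul_le (p := (X ^ 2 - 1 : ℝ[X])) (q := P)
      simp only [natDegree_X_pow]
      omega
    · have := aux_neg k hρ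
      simp only [eval_mul, eval_sub, eval_pow, eval_X, eval_one, hP', pow_zero, mul_one]
      rw [← this, hk, add_assoc, pow_add ρ j, mul_assoc]
      congr 3; ext s
      have := hcne s
      field_simp
      ring
  · refine ⟨X ^ N * (C (π / 2) * (X - 1)), ?_, by simp, fun ρ hρ => ?_⟩
    · refine le_max_of_le_left ?_
      compute_degree
    · simp only [eval_mul, eval_sub, eval_pow, eval_X, eval_one, eval_C]
      rw [← aux_mid hρ, hj]
      congr 2; ext s
      have := hcne s
      field_simp
      ring
  · obtain ⟨k, hk⟩ : ∃ k, j = N + 2 * k + 3 := by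
      obtain ⟨m, hm⟩ := h; exact ⟨m - N - 1, by omega⟩
    obtain ⟨P, hP, hP'⟩ := aux_moment 1 (X ^ 2 - 1) (by simp) hd k 0
    refine ⟨X ^ N * ((X ^ 2 - 1) * P), ?_, by simp, fun ρ hρ => ?_⟩
    · refine natDegree_mul_le.trans ?_
      have := natDegree_mul_le (p := (X ^ 2 - 1 : ℝ[X])) (q := P)
      simp only [natDegree_X_pow]
      omega
    · have := aux_pos k hρ
      simp only [eval_mul, eval_sub, eval_pow, eval_X, eval_one, hP', pow_zero, mul_one]
      rw [← this, hk]
      congr 2; ext s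
      have := hcne s
      field_simp
      ring

open Polynomial in
lemma aux_cheb (N : ℕ) (ν : ℕ) : ∀ j : ℕ, Odd (N + j + ν) →
    ∃ R : Polynomial ℝ, R.natDegree ≤ max (N + 1) (j + ν - 1) ∧ R.eval 1 = 0 ∧ ∀ ρ : ℝ, 1 < ρ →
      R.eval ρ = ρ ^ N * ∫ s in (0:ℝ)..arcosh ρ,
        cosh (ν * s) * (cosh s ^ j / cosh s ^ (N + 2) * √(ρ ^ 2 - cosh s ^ 2)) := by
  have hcne : ∀ x, cosh x ^ (N + 2) ≠ 0 := fun x => pow_ne_zero _ (cosh_pos x).ne'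
  induction ν using Nat.twoStepInduction with
  | zero =>
    intro j h
    simpa using aux_base N j h
  | one =>
    intro j h
    obtain ⟨R, h1, h2, h3⟩ := aux_base N (j + 1) h
    refine ⟨R, h1, h2, fun ρ hρ => ?_⟩
    rw [h3 ρ hρ]
    congr 2; ext s
    simp; ring
  | more ν ih0 ih1 =>
    intro j h
    obtain ⟨R, h1, h2, h3⟩ := ih0 j (by rw [Nat.odd_iff] at *; omega)
    obtain ⟨S, g1, g2, g3⟩ := ih1 (j + 1) (by rw [Nat.odd_iff] at *; omega)
    refine ⟨C 2 * S - R, ?_, by simp [h2, g2], fun ρ hρ => ?_⟩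
    · refine (natDegree_sub_le _ _).trans (max_le ((natDegree_C_mul_le _ _).trans ?_) ?_) <;> omega
    · simp only [eval_sub, eval_mul, eval_C]
      rw [h3 ρ hρ, g3 ρ hρ, mul_left_comm, ← mul_sub, ← intervalIntegral.integral_const_mul,
        ← intervalIntegral.integral_sub]
      · congr 2; ext s
        have e1 : ((ν + 2 : ℕ) : ℝ) * s = ((ν + 1 : ℕ) : ℝ) * s + s := by push_cast; ring
        have e2 : ((ν : ℕ) : ℝ) * s = ((ν + 1 : ℕ) : ℝ) * s - s := by push_cast; ring
        rw [e1, e2, cosh_add, cosh_sub]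
        ring
      · apply Continuous.intervalIntegrable
        fun_prop (disch := assumption)
      · apply Continuous.intervalIntegrable
        fun_prop (disch := assumption)


lemma lap_one (k : ℕ) {z : ℝ} (hz : 0 < z) :
    IntegrableOn (fun ρ : ℝ => exp (-z * ρ) * (ρ - 1) ^ k) (Set.Ioi 1) ∧
    ∫ ρ in Set.Ioi (1:ℝ), exp (-z * ρ) * (ρ - 1) ^ k =
      exp (-z) * (k.factorial * (1 / z) ^ (k + 1)) := by
  have key : ∫ x in Set.Ioi (0:ℝ), exp (-z) * (x ^ k * exp (-(z * x))) =
      exp (-z) * (k.factorial * (1 / z) ^ (k + 1)) := by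
    rw [integral_const_mul]
    have := Real.integral_rpow_mul_exp_neg_mul_Ioi (a := k + 1) (by positivity) hz
    simp only [add_sub_cancel_right, rpow_natCast] at this
    rw [this, Real.Gamma_nat_eq_factorial]
    norm_cast
    ring
  have hInteg : IntegrableOn (fun x : ℝ => exp (-z) * (x ^ k * exp (-(z * x)))) (Set.Ioi 0) :=
    .of_integral_ne_zero (by rw [key]; positivity)
  have mp := measurePreserving_add_right (volume : Measure ℝ) (-1)
  have me := (MeasurableEquiv.addRight (-1:ℝ)).measurableEmbedding
  have hpre : (fun x : ℝ => x + -1) ⁻¹' (Set.Ioi 0) = Set.Ioi 1 := by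
    ext x; simp
  have hfun : (fun ρ : ℝ => exp (-z * ρ) * (ρ - 1) ^ k) =
      (fun x : ℝ => exp (-z) * (x ^ k * exp (-(z * x)))) ∘ (fun x : ℝ => x + -1) := by
    ext x
    simp only [Function.comp]
    rw [show -z * x = -z + -(z * (x + -1)) by ring, exp_add]; ring
  constructor
  · rw [hfun, ← hpre]
    exact (mp.integrableOn_comp_preimage me).2 hInteg
  · have h := mp.setIntegral_preimage_emb me
      (fun x : ℝ => exp (-z) * (x ^ k * exp (-(z * x)))) (Set.Ioi 0)
    rw [hpre] at h
    rw [← key, ← h, hfun]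
    rfl

open Polynomial in
lemma lap_poly (R : Polynomial ℝ) (h1 : R.eval 1 = 0) :
    ∃ P : Polynomial ℝ, P.natDegree ≤ R.natDegree - 1 ∧ ∀ z : ℝ, 0 < z →
      IntegrableOn (fun ρ : ℝ => exp (-z * ρ) * R.eval ρ) (Set.Ioi 1) ∧
      ∫ ρ in Set.Ioi (1:ℝ), exp (-z * ρ) * R.eval ρ = (z ^ 2)⁻¹ * exp (-z) * P.eval (1 / z) := by
  set T := taylor 1 R with hT
  have hT0 : T.coeff 0 = 0 := by simp [hT, taylor_coeff_zero, h1]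
  have hTd : T.natDegree = R.natDegree := natDegree_taylor _ _
  set D := R.natDegree with hD
  have hev : ∀ ρ : ℝ, R.eval ρ = ∑ i ∈ Finset.range D, T.coeff (i + 1) * (ρ - 1) ^ (i + 1) := by
    intro ρ
    rw [← taylor_eval_sub (r := (1:ℝ)) R ρ, ← hT, eval_eq_sum_range, hTd, Finset.sum_range_succ', hT0]
    simp
  refine ⟨∑ i ∈ Finset.range D, C (T.coeff (i + 1) * (i + 1).factorial) * X ^ i, ?_, fun z hz => ?_⟩
  · refine natDegree_sum_le_of_forall_le _ _ fun i hi => ?_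
    refine (natDegree_C_mul_X_pow_le _ _).trans ?_
    have := Finset.mem_range.1 hi
    omega
  · have hfun : (fun ρ : ℝ => exp (-z * ρ) * R.eval ρ) = fun ρ =>
        ∑ i ∈ Finset.range D, T.coeff (i + 1) * (exp (-z * ρ) * (ρ - 1) ^ (i + 1)) := by
      ext ρ
      rw [hev, Finset.mul_sum]
      exact Finset.sum_congr rfl fun i _ => by ring
    have hi : ∀ i ∈ Finset.range D, IntegrableOn
        (fun ρ : ℝ => T.coeff (i + 1) * (exp (-z * ρ) * (ρ - 1) ^ (i + 1))) (Set.Ioi 1) :=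
      fun i _ => (lap_one (i + 1) hz).1.const_mul _
    rw [hfun]
    refine ⟨integrable_finsetSum _ hi, ?_⟩
    rw [integral_finsetSum _ hi, eval_finsetSum, Finset.mul_sum]
    refine Finset.sum_congr rfl fun i _ => ?_
    rw [integral_const_mul, (lap_one (i + 1) hz).2]
    simp only [eval_mul, eval_C, eval_pow, eval_X]
    rw [add_assoc i 1 1, pow_add (1 / z) i, one_add_one_eq_two]
    field_simp

lemma K_int (ν : ℕ) {z : ℝ} (hz : 0 < z) :
    IntegrableOn (fun t : ℝ => exp (-z * cosh t) * cosh (ν * t)) (Set.Ioi 0) := by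
  refine Integrable.mono' ((integrableOn_exp_neg_Ioi 0).const_mul (exp ((ν + 1) ^ 2 / z)))
    (by fun_prop) ?_
  refine (ae_restrict_iff' measurableSet_Ioi).2 (ae_of_all _ fun t ht => ?_)
  have ht : 0 < t := ht
  rw [Real.norm_of_nonneg (by positivity)]
  have h1 : cosh (ν * t) ≤ exp (ν * t) := by
    rw [← cosh_add_sinh]
    have : 0 ≤ sinh (ν * t) := sinh_nonneg_iff.2 (by positivity)
    linarith
  have h2 : t ^ 2 / 4 ≤ cosh t := by
    rw [cosh_eq]
    have := Real.quadratic_le_exp_of_nonneg ht.le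
    have := exp_pos (-t)
    linarith
  have h3 : -z * cosh t + ν * t ≤ (ν + 1) ^ 2 / z + -t := by
    have h4 : (ν + 1) * t ≤ (ν + 1) ^ 2 / z + z * (t ^ 2 / 4) := by
      have : 0 ≤ ((ν + 1) - z * t / 2) ^ 2 / z := by positivity
      have e : ((ν + 1) - z * t / 2) ^ 2 / z = (ν + 1) ^ 2 / z + z * (t ^ 2 / 4) - (ν + 1) * t := by
        field_simp; ring
      linarith
    nlinarith
  calc exp (-z * cosh t) * cosh (ν * t) ≤ exp (-z * cosh t) * exp (ν * t) := by gcongr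
    _ = exp (-z * cosh t + ν * t) := (exp_add _ _).symm
    _ ≤ exp ((ν + 1) ^ 2 / z + -t) := exp_le_exp.2 h3
    _ = _ := exp_add _ _

lemma subst_t (N ν : ℕ) (z : ℝ) {s : ℝ} :
    ∫⁻ t in Set.Ioi (0:ℝ), ENNReal.ofReal
        (cosh t ^ N * sinh t ^ 2 * (exp (-(z * cosh t) * cosh s) * cosh (ν * s))) =
    ∫⁻ ρ in Set.Ioi (1:ℝ), ENNReal.ofReal (exp (-z * ρ) * (ρ ^ N * (cosh (ν * s) *
        (cosh s ^ 0 / cosh s ^ (N + 2) * √(ρ ^ 2 - cosh s ^ 2))))) := by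
  have hc := cosh_pos s
  have hc1 := one_le_cosh s
  have himg : Set.image (fun t => cosh t * cosh s) (Set.Ioi 0) = Set.Ioi (cosh s) := by
    ext ρ
    constructor
    · rintro ⟨t, ht, rfl⟩
      have : 1 < cosh t := one_lt_cosh.2 (ne_of_gt ht)
      simp only [Set.mem_Ioi]
      nlinarith
    · intro hρ
      have hρ : cosh s < ρ := hρ
      have h1 : 1 < ρ / cosh s := (one_lt_div hc).2 hρ
      refine ⟨arcosh (ρ / cosh s), arcosh_pos h1, ?_⟩
      simp only [cosh_arcosh h1.le]
      field_simp
  have hsub := lintegral_image_eq_lintegral_abs_deriv_mul (s := Set.Ioi (0:ℝ))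
    (f := fun t => cosh t * cosh s) (f' := fun t => sinh t * cosh s) measurableSet_Ioi
    (fun t _ => ((hasDerivAt_cosh t).mul_const _).hasDerivWithinAt)
    (by
      intro a ha b hb hab
      have : cosh a = cosh b := mul_right_cancel₀ hc.ne' hab
      rw [← arcosh_cosh (le_of_lt ha), this, arcosh_cosh (le_of_lt hb)])
    (fun ρ => ENNReal.ofReal (exp (-z * ρ) * (ρ ^ N * (cosh (ν * s) *
        (cosh s ^ 0 / cosh s ^ (N + 2) * √(ρ ^ 2 - cosh s ^ 2))))))
  have hset : ∫⁻ ρ in Set.Ioi (1:ℝ), ENNReal.ofReal (exp (-z * ρ) * (ρ ^ N * (cosh (ν * s) *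
        (cosh s ^ 0 / cosh s ^ (N + 2) * √(ρ ^ 2 - cosh s ^ 2))))) =
      ∫⁻ ρ in Set.Ioi (cosh s), ENNReal.ofReal (exp (-z * ρ) * (ρ ^ N * (cosh (ν * s) *
        (cosh s ^ 0 / cosh s ^ (N + 2) * √(ρ ^ 2 - cosh s ^ 2))))) := by
    rw [← lintegral_indicator measurableSet_Ioi, ← lintegral_indicator measurableSet_Ioi]
    congr 1; ext ρ
    by_cases h1 : cosh s < ρ
    · rw [Set.indicator_of_mem (show ρ ∈ Set.Ioi 1 from lt_of_le_of_lt hc1 h1),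
        Set.indicator_of_mem (show ρ ∈ Set.Ioi (cosh s) from h1)]
    · rw [Set.indicator_of_notMem (show ρ ∉ Set.Ioi (cosh s) from h1)]
      by_cases h2 : 1 < ρ
      · rw [Set.indicator_of_mem (show ρ ∈ Set.Ioi 1 from h2),
          Real.sqrt_eq_zero_of_nonpos (by nlinarith)]
        simp
      · rw [Set.indicator_of_notMem (show ρ ∉ Set.Ioi 1 from h2)]
  rw [hset, ← himg, hsub]
  refine setLIntegral_congr_fun measurableSet_Ioi fun t ht => ?_
  have hst : 0 < sinh t := sinh_pos_iff.2 ht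
  rw [← ENNReal.ofReal_mul (abs_nonneg _), abs_of_pos (by positivity)]
  congr 1
  have e : √((cosh t * cosh s) ^ 2 - cosh s ^ 2) = sinh t * cosh s := by
    rw [← Real.sqrt_sq (show 0 ≤ sinh t * cosh s by positivity)]
    congr 1
    rw [mul_pow, cosh_sq t]; ring
  rw [e, show -(z * cosh t) * cosh s = -z * (cosh t * cosh s) by ring]
  field_simp
  ring

lemma inner_s (N ν : ℕ) (z : ℝ) {ρ : ℝ} (hρ : 1 < ρ) :
    0 ≤ (∫ s in (0:ℝ)..arcosh ρ, cosh (ν * s) *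
        (cosh s ^ 0 / cosh s ^ (N + 2) * √(ρ ^ 2 - cosh s ^ 2))) ∧
    ∫⁻ s in Set.Ioi (0:ℝ), ENNReal.ofReal (exp (-z * ρ) * (ρ ^ N * (cosh (ν * s) *
        (cosh s ^ 0 / cosh s ^ (N + 2) * √(ρ ^ 2 - cosh s ^ 2))))) =
    ENNReal.ofReal (exp (-z * ρ) * (ρ ^ N * ∫ s in (0:ℝ)..arcosh ρ, cosh (ν * s) *
        (cosh s ^ 0 / cosh s ^ (N + 2) * √(ρ ^ 2 - cosh s ^ 2)))) := by
  have hcne : ∀ x, cosh x ^ (N + 2) ≠ 0 := fun x => pow_ne_zero _ (cosh_pos x).ne'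
  have hb := arcosh_nonneg hρ.le
  have hnn : ∀ s, 0 ≤ cosh (ν * s) * (cosh s ^ 0 / cosh s ^ (N + 2) * √(ρ ^ 2 - cosh s ^ 2)) := by
    intro s
    have := cosh_pos s
    positivity
  have hρ0 : 0 < ρ := by linarith
  refine ⟨intervalIntegral.integral_nonneg hb fun s _ => hnn s, ?_⟩
  have hset : ∫⁻ s in Set.Ioi (0:ℝ), ENNReal.ofReal (exp (-z * ρ) * (ρ ^ N * (cosh (ν * s) *
        (cosh s ^ 0 / cosh s ^ (N + 2) * √(ρ ^ 2 - cosh s ^ 2))))) =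
      ∫⁻ s in Set.Ioc (0:ℝ) (arcosh ρ), ENNReal.ofReal (exp (-z * ρ) * (ρ ^ N * (cosh (ν * s) *
        (cosh s ^ 0 / cosh s ^ (N + 2) * √(ρ ^ 2 - cosh s ^ 2))))) := by
    rw [← lintegral_indicator measurableSet_Ioi, ← lintegral_indicator measurableSet_Ioc]
    congr 1; ext s
    by_cases h0 : 0 < s
    · rw [Set.indicator_of_mem (show s ∈ Set.Ioi 0 from h0)]
      by_cases h1 : s ≤ arcosh ρ
      · rw [Set.indicator_of_mem (show s ∈ Set.Ioc 0 (arcosh ρ) from ⟨h0, h1⟩)]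
      · rw [Set.indicator_of_notMem (fun h => h1 h.2)]
        have h3 : ρ < cosh s := by
          have := (Real.cosh_lt_cosh (x := arcosh ρ) (y := s)).2
            (by rw [abs_of_nonneg h0.le, abs_of_nonneg hb]; exact not_le.1 h1)
          rwa [cosh_arcosh hρ.le] at this
        rw [Real.sqrt_eq_zero_of_nonpos (by nlinarith)]
        simp
    · rw [Set.indicator_of_notMem (show s ∉ Set.Ioi 0 from h0),
        Set.indicator_of_notMem (fun h => h0 h.1)]
  rw [hset, ← intervalIntegral.integral_const_mul, ← intervalIntegral.integral_const_mul,
    intervalIntegral.integral_of_le hb, ofReal_integral_eq_lintegral_ofReal]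
  · have : Continuous fun s => exp (-z * ρ) * (ρ ^ N * (cosh (ν * s) *
        (cosh s ^ 0 / cosh s ^ (N + 2) * √(ρ ^ 2 - cosh s ^ 2)))) := by
      fun_prop (disch := assumption)
    exact this.integrableOn_Ioc
  · refine ae_of_all _ fun s => ?_
    have := hnn s
    simp only [Pi.zero_apply]
    positivity

lemma G_eq (N ν : ℕ) (R : Polynomial ℝ) {z : ℝ} (hz : 0 < z)
    (hR : ∀ ρ : ℝ, 1 < ρ → R.eval ρ = ρ ^ N * ∫ s in (0:ℝ)..arcosh ρ,
        cosh (ν * s) * (cosh s ^ 0 / cosh s ^ (N + 2) * √(ρ ^ 2 - cosh s ^ 2))) :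
    G N ν z = ∫ ρ in Set.Ioi (1:ℝ), exp (-z * ρ) * R.eval ρ := by
  have hcne : ∀ x : ℝ × ℝ, cosh x.1 ^ (N + 2) ≠ 0 := fun x => pow_ne_zero _ (cosh_pos _).ne'
  have hKm : StronglyMeasurable fun t => besselK ν (z * cosh t) := by
    unfold besselK
    apply StronglyMeasurable.integral_prod_right
    apply Continuous.stronglyMeasurable
    unfold Function.uncurry
    fun_prop
  have hKn : ∀ t, 0 ≤ besselK ν (z * cosh t) := fun t =>
    integral_nonneg fun s => by positivity
  rw [integral_eq_lintegral_of_nonneg_ae, G, integral_eq_lintegral_of_nonneg_ae]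
  · congr 1
    calc _ = ∫⁻ t in Set.Ioi (0:ℝ), ∫⁻ s in Set.Ioi (0:ℝ), ENNReal.ofReal
            (cosh t ^ N * sinh t ^ 2 * (exp (-(z * cosh t) * cosh s) * cosh (ν * s))) := by
          refine setLIntegral_congr_fun measurableSet_Ioi fun t ht => ?_
          have hct := cosh_pos t
          rw [← ofReal_integral_eq_lintegral_ofReal, integral_const_mul, besselK]
          · congr 1; ring
          · exact (K_int ν (by positivity)).const_mul _
          · exact ae_of_all _ fun s => by simp only [Pi.zero_apply]; positivity
      _ = ∫⁻ s in Set.Ioi (0:ℝ), ∫⁻ t in Set.Ioi (0:ℝ), ENNReal.ofReal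
            (cosh t ^ N * sinh t ^ 2 * (exp (-(z * cosh t) * cosh s) * cosh (ν * s))) := by
          apply lintegral_lintegral_swap
          unfold Function.uncurry
          apply Measurable.aemeasurable
          apply ENNReal.measurable_ofReal.comp
          apply Continuous.measurable
          fun_prop
      _ = ∫⁻ s in Set.Ioi (0:ℝ), ∫⁻ ρ in Set.Ioi (1:ℝ), ENNReal.ofReal
            (exp (-z * ρ) * (ρ ^ N * (cosh (ν * s) *
            (cosh s ^ 0 / cosh s ^ (N + 2) * √(ρ ^ 2 - cosh s ^ 2))))) := by
          simp_rw [subst_t]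
      _ = ∫⁻ ρ in Set.Ioi (1:ℝ), ∫⁻ s in Set.Ioi (0:ℝ), ENNReal.ofReal
            (exp (-z * ρ) * (ρ ^ N * (cosh (ν * s) *
            (cosh s ^ 0 / cosh s ^ (N + 2) * √(ρ ^ 2 - cosh s ^ 2))))) := by
          apply lintegral_lintegral_swap
          unfold Function.uncurry
          apply Measurable.aemeasurable
          apply ENNReal.measurable_ofReal.comp
          apply Continuous.measurable
          fun_prop (disch := assumption)
      _ = _ := by
          refine setLIntegral_congr_fun measurableSet_Ioi fun ρ hρ => ?_
          rw [(inner_s N ν z hρ).2, hR ρ hρ]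
  · exact ae_of_all _ fun t => by
      have := hKn t
      have := cosh_pos t
      simp only [Pi.zero_apply]; positivity
  · apply StronglyMeasurable.aestronglyMeasurable
    refine StronglyMeasurable.mul (StronglyMeasurable.mul ?_ hKm) ?_
    · apply Continuous.stronglyMeasurable; fun_prop
    · apply Continuous.stronglyMeasurable; fun_prop
  · refine (ae_restrict_iff' measurableSet_Ioi).2 (ae_of_all _ fun ρ hρ => ?_)
    have h1 : 1 < ρ := hρ
    have h0 : 0 < ρ := by linarith
    have := (inner_s N ν z h1).1
    simp only [Pi.zero_apply]
    rw [hR ρ h1]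
    positivity
  · apply Continuous.aestronglyMeasurable
    fun_prop

theorem G_polynomial_degree (N ν : ℕ)
    (h : (Odd N ∧ Even ν) ∨ (Even N ∧ Odd ν)) :
    ∃ P : Polynomial ℝ,
      (∀ z : ℝ, 0 < z → G N (ν : ℝ) z = (z ^ 2)⁻¹ * Real.exp (-z) * P.eval (1 / z)) ∧
      (N + 2 < ν → P.natDegree ≤ (ν - 1) - 1) ∧
      (ν < N + 2 → P.natDegree ≤ (N + 1) - 1) := by
  obtain ⟨R, hd, h1, hR⟩ := aux_cheb N ν 0 (by
    rcases h with ⟨h1, h2⟩ | ⟨h1, h2⟩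
    · exact h1.add_even h2
    · exact h1.add_odd h2)
  obtain ⟨P, hP, hP'⟩ := lap_poly R h1
  refine ⟨P, fun z hz => ?_, fun hlt => ?_, fun hlt => ?_⟩
  · rw [G_eq N ν R hz hR, (hP' z hz).2]
  · omega
  · omega
end
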